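/- Let E_n denote the number of quarter-plane walks of length n with steps from ℰ = {(−1,1),(0,1),(1,1),(1,−1)}, and let E(t) = Σ_{n≥0} E_n t^n be the associated formal power series over ℚ. Then E(t) is not D-finite: there do not exist a natural number r and polynomials p_0,…,p_r ∈ ℚ[t], not all zero, such that Σ_{i=0}^r p_i(t)·E^{(i)}(t) = 0 as formal power series. -/

import Mathlib

/-- The number of quarter-plane walks of length `n` with steps from `S`:
sequences of `n` steps, each in `S`, all of whose partial sums have both
coordinates nonnegative. -/
noncomputable def quarterPlaneWalks (S : Finset (ℤ × ℤ)) (n : ℕ) : ℕ :=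
  Nat.card {f : Fin n → ℤ × ℤ //
    (∀ k, f k ∈ S) ∧
    ∀ k : Fin n, 0 ≤ ∑ j ∈ Finset.Iic k, (f j).1 ∧ 0 ≤ ∑ j ∈ Finset.Iic k, (f j).2}

/-- The counting generating function of quarter-plane walks with steps
from `S`, as a formal power series over ℚ. -/
noncomputable def walkGF (S : Finset (ℤ × ℤ)) : PowerSeries ℚ :=
  PowerSeries.mk fun n => (quarterPlaneWalks S n : ℚ)

namespace ModelE

open Finset

/-- the step set -/
abbrev SE : Finset (ℤ × ℤ) := {(-1,1),(0,1),(1,1),(1,-1)}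

/-- the quarter plane condition -/
def Ok {n : ℕ} (f : Fin n → ℤ × ℤ) : Prop :=
  ∀ k : Fin n, 0 ≤ ∑ j ∈ Finset.Iic k, (f j).1 ∧ 0 ≤ ∑ j ∈ Finset.Iic k, (f j).2

open Classical in
/-- weighted count of walks by endpoint -/
noncomputable def Qn (n : ℕ) (x y : ℂ) : ℂ :=
  ∑ f ∈ Fintype.piFinset (fun _ : Fin n => SE),
    if Ok f then x ^ (∑ j, (f j).1).toNat * y ^ (∑ j, (f j).2).toNat else 0

lemma ok_end {n : ℕ} (f : Fin n → ℤ × ℤ) (h : Ok f) :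
    0 ≤ ∑ j, (f j).1 ∧ 0 ≤ ∑ j, (f j).2 := by
  cases n with
  | zero => simp
  | succ n =>
    have := h (Fin.last n)
    have e : Finset.Iic (Fin.last n) = Finset.univ := by ext; simp [Fin.le_last]
    rwa [e] at this

lemma ok_snoc {n : ℕ} (f : Fin n → ℤ × ℤ) (s : ℤ × ℤ) :
    Ok (Fin.snoc f s : Fin (n+1) → ℤ × ℤ) ↔
      Ok f ∧ 0 ≤ ∑ j, (f j).1 + s.1 ∧ 0 ≤ ∑ j, (f j).2 + s.2 := by
  unfold Ok
  have e : Finset.Iic (Fin.last n) = Finset.univ := by ext; simp [Fin.le_last]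
  have e2 : ∀ k : Fin n, Finset.Iic k.castSucc = (Finset.Iic k).map Fin.castSuccEmb := by
    intro k; simp
  constructor
  · intro h
    refine ⟨fun k => ?_, ?_⟩
    · have := h k.castSucc
      rw [e2, Finset.sum_map, Finset.sum_map] at this
      simpa only [Fin.coe_castSuccEmb, Fin.snoc_castSucc] using this
    · have := h (Fin.last n)
      rw [e] at this
      simpa [Fin.sum_univ_castSucc] using this
  · rintro ⟨h1, h2⟩ k
    refine Fin.lastCases ?_ (fun k => ?_) k
    · rw [e]
      simpa [Fin.sum_univ_castSucc] using h2
    · rw [e2, Finset.sum_map, Finset.sum_map]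
      simpa only [Fin.coe_castSuccEmb, Fin.snoc_castSucc] using h1 k

lemma sum_snoc {n : ℕ} (g : (Fin (n+1) → ℤ × ℤ) → ℂ) :
    ∑ f ∈ Fintype.piFinset (fun _ : Fin (n+1) => SE), g f =
    ∑ f ∈ Fintype.piFinset (fun _ : Fin n => SE), ∑ s ∈ SE, g (Fin.snoc f s) := by
  rw [← Finset.sum_product']
  refine Finset.sum_nbij' (fun f => (Fin.init f, f (Fin.last n)))
    (fun p => (Fin.snoc p.1 p.2 : Fin (n+1) → ℤ × ℤ)) ?_ ?_ ?_ ?_ ?_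
  · intro f hf
    simp only [Fintype.mem_piFinset, Finset.mem_product] at hf ⊢
    exact ⟨fun k => hf _, hf _⟩
  · intro p hp
    simp only [Fintype.mem_piFinset, Finset.mem_product] at hp ⊢
    intro k
    refine Fin.lastCases ?_ (fun k => ?_) k
    · simpa using hp.2
    · simpa using hp.1 k
  · intro f _; simp
  · intro p _; simp
  · intro f _; simp

lemma Qn_zero (x y : ℂ) : Qn 0 x y = 1 := by
  have : Ok (default : Fin 0 → ℤ × ℤ) := fun k => k.elim0
  simp [Qn, Ok]

lemma one_step (x y : ℂ) (a b : ℕ) :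
    x * y * ∑ s ∈ SE, (if 0 ≤ (a:ℤ) + s.1 ∧ 0 ≤ (b:ℤ) + s.2 then
        x ^ ((a:ℤ) + s.1).toNat * y ^ ((b:ℤ) + s.2).toNat else 0) =
      (y^2 * (x^2 + x + 1) + x^2) * (x^a * y^b) - y^2 * (0^a * y^b) - x^2 * (x^a * 0^b) := by
  have e1 : ((a:ℤ)+1).toNat = a+1 := by omega
  have e2 : ((b:ℤ)+1).toNat = b+1 := by omega
  rw [SE, Finset.sum_insert (by decide), Finset.sum_insert (by decide),
    Finset.sum_insert (by decide), Finset.sum_singleton]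
  rcases a with _ | a <;> rcases b with _ | b
  · simp; ring
  · have e3 : 0 ≤ ((b:ℤ)+1+1) := by omega
    have e4 : ((b:ℤ)+1+1).toNat = b+2 := by omega
    simp [e3, e4]; ring
  · have e3 : 0 ≤ ((a:ℤ)+1+1) := by omega
    have e4 : ((a:ℤ)+1+1).toNat = a+2 := by omega
    have e5 : ((a:ℤ)+1).toNat = a+1 := by omega
    have e6 : 0 ≤ (a:ℤ)+1 := by omega
    simp [e3, e4, e5, e6]; ring
  · have e3 : 0 ≤ ((a:ℤ)+1+1) := by omega
    have e4 : ((a:ℤ)+1+1).toNat = a+2 := by omega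
    have e5 : ((a:ℤ)+1).toNat = a+1 := by omega
    have e6 : 0 ≤ (a:ℤ)+1 := by omega
    have e3' : 0 ≤ ((b:ℤ)+1+1) := by omega
    have e4' : ((b:ℤ)+1+1).toNat = b+2 := by omega
    simp [e3, e4, e5, e6, e3', e4']; ring

lemma Qn_succ (n : ℕ) (x y : ℂ) :
    x * y * Qn (n+1) x y = (y^2 * (x^2 + x + 1) + x^2) * Qn n x y
      - y^2 * Qn n 0 y - x^2 * Qn n x 0 := by
  unfold Qn
  rw [sum_snoc, Finset.mul_sum, Finset.mul_sum, Finset.mul_sum, Finset.mul_sum,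
    ← Finset.sum_sub_distrib, ← Finset.sum_sub_distrib]
  refine Finset.sum_congr rfl fun f _ => ?_
  by_cases h : Ok f
  · obtain ⟨h1, h2⟩ := ok_end f h
    obtain ⟨a, ha⟩ := Int.eq_ofNat_of_zero_le h1
    obtain ⟨b, hb⟩ := Int.eq_ofNat_of_zero_le h2
    have := one_step x y a b
    simp only [ok_snoc, h, true_and, ha, hb, Fin.sum_univ_castSucc, Fin.snoc_castSucc,
      Fin.snoc_last, if_true, Int.toNat_natCast] at this ⊢
    exact this
  · simp [ok_snoc, h]

lemma Qn_norm_le (n : ℕ) (x y : ℂ) (hx : ‖x‖ ≤ 1) (hy : ‖y‖ ≤ 1) : ‖Qn n x y‖ ≤ 4 ^ n := by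
  unfold Qn
  refine (norm_sum_le _ _).trans ?_
  have : ∀ f ∈ Fintype.piFinset (fun _ : Fin n => SE),
      ‖(open Classical in if Ok f then x ^ (∑ j, (f j).1).toNat * y ^ (∑ j, (f j).2).toNat else 0)‖
        ≤ (1:ℝ) := by
    intro f _
    split_ifs
    · rw [norm_mul, norm_pow, norm_pow]
      exact mul_le_one₀ (pow_le_one₀ (norm_nonneg _) hx) (by positivity)
        (pow_le_one₀ (norm_nonneg _) hy)
    · simp
  refine (Finset.sum_le_sum this).trans ?_
  have h4 : SE.card = 4 := by decide
  simp [Fintype.card_piFinset, h4]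

lemma Qn_one (n : ℕ) : Qn n 1 1 = (quarterPlaneWalks SE n : ℂ) := by
  classical
  unfold Qn quarterPlaneWalks
  have : Nat.card {f : Fin n → ℤ × ℤ // (∀ k, f k ∈ SE) ∧
    ∀ k : Fin n, 0 ≤ ∑ j ∈ Finset.Iic k, (f j).1 ∧ 0 ≤ ∑ j ∈ Finset.Iic k, (f j).2} =
      ((Fintype.piFinset (fun _ : Fin n => SE)).filter Ok).card := by
    rw [← Nat.card_eq_finsetCard]
    refine Nat.card_congr (Equiv.subtypeEquivRight ?_)
    intro f
    simp [Ok, Fintype.mem_piFinset]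
  rw [this]
  simp

end ModelE

namespace ModelE
open Finset Filter Topology

/-- generating function with endpoints -/
noncomputable def GG (t x y : ℂ) : ℂ := ∑' n, t ^ n * Qn n x y

lemma GG_summable {t x y : ℂ} (ht : ‖t‖ ≤ 1/8) (hx : ‖x‖ ≤ 1) (hy : ‖y‖ ≤ 1) :
    Summable (fun n => t ^ n * Qn n x y) := by
  refine Summable.of_norm_bounded (g := fun n => ((1:ℝ)/2)^n)
    (summable_geometric_of_lt_one (by norm_num) (by norm_num)) fun n => ?_
  rw [norm_mul, norm_pow]
  calc ‖t‖ ^ n * ‖Qn n x y‖ ≤ (1/8)^n * 4^n := by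
        gcongr
        exact Qn_norm_le n x y hx hy
    _ = (1/2)^n := by rw [← mul_pow]; norm_num

lemma GG_norm_le {t x y : ℂ} (ht : ‖t‖ ≤ 1/8) (hx : ‖x‖ ≤ 1) (hy : ‖y‖ ≤ 1) :
    ‖GG t x y‖ ≤ 2 := by
  have h : ∀ n, ‖t ^ n * Qn n x y‖ ≤ ((1:ℝ)/2)^n := fun n => by
    rw [norm_mul, norm_pow]
    calc ‖t‖ ^ n * ‖Qn n x y‖ ≤ (1/8)^n * 4^n := by
          gcongr
          exact Qn_norm_le n x y hx hy
      _ = (1/2)^n := by rw [← mul_pow]; norm_num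
  exact tsum_of_norm_bounded hasSum_geometric_two h

lemma GG_eq {t x y : ℂ} (ht : ‖t‖ ≤ 1/8) (hx : ‖x‖ ≤ 1) (hy : ‖y‖ ≤ 1) :
    (x * y - t * (y^2 * (x^2 + x + 1) + x^2)) * GG t x y =
      x * y - t * y^2 * GG t 0 y - t * x^2 * GG t x 0 := by
  have h0 : ‖(0:ℂ)‖ ≤ 1 := by simp
  have s1 := GG_summable ht hx hy
  have s2 := GG_summable ht h0 hy
  have s3 := GG_summable ht hx h0
  have e : x * y * GG t x y = x * y + ∑' n, t ^ (n+1) * (x * y * Qn (n+1) x y) := by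
    unfold GG
    rw [s1.tsum_eq_zero_add, mul_add, ← tsum_mul_left]
    simp only [Qn_zero, pow_zero, mul_one]
    congr 1
    refine tsum_congr fun n => ?_
    ring
  have e2 : ∑' n, t ^ (n+1) * (x * y * Qn (n+1) x y) =
      t * (y^2 * (x^2 + x + 1) + x^2) * GG t x y - t * y^2 * GG t 0 y - t * x^2 * GG t x 0 := by
    unfold GG
    rw [← tsum_mul_left, ← tsum_mul_left, ← tsum_mul_left,
      ← (s1.mul_left _).tsum_sub (s2.mul_left _),
      ← ((s1.mul_left _).sub (s2.mul_left _)).tsum_sub (s3.mul_left _)]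
    refine tsum_congr fun n => ?_
    rw [Qn_succ]
    ring
  rw [sub_mul, e, e2]
  ring

/-- the orbit sequence of the (reciprocal) kernel roots -/
noncomputable def sq (τ u1 : ℂ) (p : ℕ) : ℕ → ℂ
  | 0 => 1
  | 1 => u1
  | n+2 => τ * sq τ u1 p (n+1) - sq τ u1 p n - (if (n+1+p) % 2 = 1 then 1 else 0)

/-- the alternating sum -/
noncomputable def SS (τ u1 : ℂ) (p : ℕ) : ℂ :=
  ∑' n, (-1)^n / (sq τ u1 p n * sq τ u1 p (n+1))

/-- the conic -/
def con (τ U V : ℂ) : ℂ := U^2 + V^2 - τ * U * V + U + 1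

lemma sq_con {τ u1 : ℂ} {p : ℕ}
    (h0 : if p % 2 = 0 then con τ 1 u1 = 0 else con τ u1 1 = 0) (n : ℕ) :
    if (n + p) % 2 = 0 then con τ (sq τ u1 p n) (sq τ u1 p (n+1)) = 0
      else con τ (sq τ u1 p (n+1)) (sq τ u1 p n) = 0 := by
  induction n with
  | zero => simpa [sq] using h0
  | succ n ih =>
    rw [sq]
    by_cases h : (n + p) % 2 = 0
    · have h' : ¬ (n + 1 + p) % 2 = 0 := by omega
      have h'' : (n + 1 + p) % 2 = 1 := by omega
      rw [if_pos h] at ih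
      rw [if_neg h', if_pos h'']
      refine Eq.trans ?_ ih; unfold con; ring
    · have h' : (n + 1 + p) % 2 = 0 := by omega
      have h'' : ¬ (n + 1 + p) % 2 = 1 := by omega
      rw [if_neg h] at ih
      rw [if_pos h', if_neg h'']
      refine Eq.trans ?_ ih; unfold con; ring

lemma sq_growth {τ u1 : ℂ} {p : ℕ} (hτ : 8 ≤ ‖τ‖) (h1 : 2 ≤ ‖u1‖) (n : ℕ) :
    1 ≤ ‖sq τ u1 p n‖ ∧ 2 * ‖sq τ u1 p n‖ ≤ ‖sq τ u1 p (n+1)‖ := by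
  induction n with
  | zero => simpa [sq] using h1
  | succ n ih =>
    obtain ⟨ih1, ih2⟩ := ih
    have hb : 1 ≤ ‖sq τ u1 p (n+1)‖ := by linarith
    refine ⟨hb, ?_⟩
    rw [sq]
    have h2 : ‖(if (n+1+p) % 2 = 1 then (1:ℂ) else 0)‖ ≤ 1 := by split_ifs <;> simp
    have h3 := norm_sub_norm_le (τ * sq τ u1 p (n+1) - sq τ u1 p n)
      (if (n+1+p) % 2 = 1 then (1:ℂ) else 0)
    have h4 := norm_sub_norm_le (τ * sq τ u1 p (n+1)) (sq τ u1 p n)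
    rw [norm_mul] at h4
    nlinarith [norm_nonneg (sq τ u1 p n)]

lemma sq_pow {τ u1 : ℂ} {p : ℕ} (hτ : 8 ≤ ‖τ‖) (h1 : 2 ≤ ‖u1‖) (n : ℕ) :
    2 ^ n ≤ ‖sq τ u1 p n‖ := by
  induction n with
  | zero => simp [sq]
  | succ n ih =>
    have := (sq_growth (p := p) hτ h1 n).2
    rw [pow_succ]; linarith

lemma alt_tel (r w : ℕ → ℂ) (h : ∀ n, r n + r (n+1) = w n) (hr : Tendsto r atTop (𝓝 0))
    (hs : Summable (fun n => (-1)^n * w n)) : r 0 = ∑' n, (-1)^n * w n := by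
  have hp : ∀ N, ∑ n ∈ range N, (-1)^n * w n = r 0 - (-1)^N * r N := by
    intro N
    induction N with
    | zero => simp
    | succ N ih => rw [sum_range_succ, ih, ← h]; ring
  have h1 := hs.hasSum.tendsto_sum_nat
  have h2 : Tendsto (fun N => (-1:ℂ)^N * r N) atTop (𝓝 0) := by
    rw [tendsto_zero_iff_norm_tendsto_zero] at hr ⊢
    simpa using hr
  have h3 : Tendsto (fun N => r 0 - (-1:ℂ)^N * r N) atTop (𝓝 (r 0 - 0)) :=
    tendsto_const_nhds.sub h2
  simp only [hp] at h1
  simpa using tendsto_nhds_unique h3 h1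

lemma kernel_pair {t τ U V : ℂ} (ht : ‖t‖ ≤ 1/8) (htτ : t * τ = 1) (hU : 1 ≤ ‖U‖) (hV : 1 ≤ ‖V‖)
    (hc : con τ U V = 0) :
    t * (1/U)^2 * GG t (1/U) 0 + t * (1/V)^2 * GG t 0 (1/V) = 1 / (U * V) := by
  have hU0 : U ≠ 0 := by rintro rfl; norm_num at hU
  have hV0 : V ≠ 0 := by rintro rfl; norm_num at hV
  have hx : ‖1/U‖ ≤ 1 := by
    rw [norm_div, norm_one]; exact (div_le_one (by linarith)).2 hU
  have hy : ‖1/V‖ ≤ 1 := by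
    rw [norm_div, norm_one]; exact (div_le_one (by linarith)).2 hV
  have h := GG_eq ht hx hy
  have hk : (1/U) * (1/V) - t * ((1/V)^2 * ((1/U)^2 + (1/U) + 1) + (1/U)^2) = 0 := by
    field_simp
    unfold con at hc
    linear_combination (-t) * hc - U * V * htτ
  rw [hk, zero_mul] at h
  have e : 1 / (U * V) = 1/U * (1/V) := by rw [one_div_mul_one_div]
  rw [e]
  linear_combination h

lemma SS_eq {t τ u1 : ℂ} {p : ℕ} (ht : ‖t‖ ≤ 1/8) (htτ : t * τ = 1) (h1 : 2 ≤ ‖u1‖)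
    (h0 : if p % 2 = 0 then con τ 1 u1 = 0 else con τ u1 1 = 0) :
    SS τ u1 p = if p % 2 = 0 then t * GG t 1 0 else t * GG t 0 1 := by
  have hτ : 8 ≤ ‖τ‖ := by
    have : ‖t‖ * ‖τ‖ = 1 := by rw [← norm_mul, htτ, norm_one]
    nlinarith [norm_nonneg τ]
  set s := sq τ u1 p with hs
  have hge : ∀ n, 1 ≤ ‖s n‖ := fun n => (sq_growth hτ h1 n).1
  have hpow : ∀ n, 2 ^ n ≤ ‖s n‖ := fun n => sq_pow hτ h1 n
  have hinv : ∀ n, ‖1 / s n‖ ≤ (1/2)^n := fun n => by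
    rw [norm_div, norm_one, one_div_pow]
    exact one_div_le_one_div_of_le (by positivity) (hpow n)
  have hinv1 : ∀ n, ‖1 / s n‖ ≤ 1 := fun n => (hinv n).trans (pow_le_one₀ (by norm_num) (by norm_num))
  set r : ℕ → ℂ := fun n => if (n + p) % 2 = 0 then t * (1/s n)^2 * GG t (1/s n) 0
    else t * (1/s n)^2 * GG t 0 (1/s n) with hr
  have hrel : ∀ n, r n + r (n+1) = 1 / (s n * s (n+1)) := by
    intro n
    have hc := sq_con h0 n
    by_cases h : (n + p) % 2 = 0
    · have h' : ¬ (n + 1 + p) % 2 = 0 := by omega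
      simp only [hr, if_pos h, if_neg h']
      rw [if_pos h] at hc
      exact kernel_pair ht htτ (hge _) (hge _) hc
    · have h' : (n + 1 + p) % 2 = 0 := by omega
      simp only [hr, if_neg h, if_pos h']
      rw [if_neg h] at hc
      rw [add_comm, mul_comm (s n)]
      exact kernel_pair ht htτ (hge _) (hge _) hc
  have hr0 : Tendsto r atTop (𝓝 0) := by
    refine squeeze_zero_norm (a := fun n => ((1:ℝ)/2)^n) (fun n => ?_)
      (tendsto_pow_atTop_nhds_zero_of_lt_one (by norm_num) (by norm_num))
    have key : ∀ g : ℂ, ‖g‖ ≤ 2 → ‖t * (1/s n)^2 * g‖ ≤ (1/2)^n := by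
      intro g hg
      rw [norm_mul, norm_mul, norm_pow]
      calc ‖t‖ * ‖1/s n‖^2 * ‖g‖ ≤ (1/8) * ((1/2)^n * 1) * 2 := by
            gcongr
            rw [pow_two]
            exact mul_le_mul (hinv n) (hinv1 n) (norm_nonneg _) (by positivity)
        _ ≤ (1/2)^n := by nlinarith [pow_pos (show (0:ℝ) < 1/2 by norm_num) n]
    simp only [hr]
    split_ifs
    · exact key _ (GG_norm_le ht (hinv1 n) (by simp))
    · exact key _ (GG_norm_le ht (by simp) (hinv1 n))
  have hsum : Summable (fun n => (-1:ℂ)^n * (1 / (s n * s (n+1)))) := by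
    refine Summable.of_norm_bounded (g := fun n => ((1:ℝ)/2)^n)
      (summable_geometric_of_lt_one (by norm_num) (by norm_num)) fun n => ?_
    rw [norm_mul, norm_pow, norm_neg, norm_one, one_pow, one_mul, ← one_div_mul_one_div, norm_mul]
    calc _ ≤ ((1:ℝ)/2)^n * 1 := mul_le_mul (hinv n) (hinv1 _) (norm_nonneg _) (by positivity)
      _ = _ := mul_one _
  have := alt_tel r _ hrel hr0 hsum
  have e : SS τ u1 p = ∑' n, (-1:ℂ)^n * (1 / (s n * s (n+1))) := by
    unfold SS
    refine tsum_congr fun n => ?_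
    rw [mul_one_div]
  rw [e, ← this]
  have es : s 0 = 1 := by simp [hs, ModelE.sq]
  simp only [hr, zero_add, es]
  simp

theorem E_formula {t τ u1 v1 : ℂ} (ht : ‖t‖ ≤ 1/8) (htτ : t * τ = 1) (h1 : 2 ≤ ‖u1‖)
    (h2 : 2 ≤ ‖v1‖) (hu : con τ 1 u1 = 0) (hv : con τ v1 1 = 0) :
    (1 - 4 * t) * ∑' n, (quarterPlaneWalks SE n : ℂ) * t ^ n = 1 - SS τ u1 0 - SS τ v1 1 := by
  rw [SS_eq (p := 0) ht htτ h1 (by simpa using hu), SS_eq (p := 1) ht htτ h2 (by simpa using hv)]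
  have h := GG_eq (t := t) (x := 1) (y := 1) ht (by simp) (by simp)
  have e : GG t 1 1 = ∑' n, (quarterPlaneWalks SE n : ℂ) * t ^ n := by
    unfold GG
    refine tsum_congr fun n => ?_
    rw [Qn_one, mul_comm]
  rw [e] at h
  norm_num at h ⊢
  linear_combination h

end ModelE

namespace ModelE
open Finset Filter Topology

/-- periodic particular solution -/
noncomputable def cn (τ : ℂ) (p n : ℕ) : ℂ :=
  if (n + p) % 2 = 0 then 2 / (τ^2 - 4) else τ / (τ^2 - 4)

/-- growing coefficient -/
noncomputable def bt (τ u1 q : ℂ) (p : ℕ) : ℂ := (u1 - cn τ p 1) - q * (1 - cn τ p 0)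

/-- decaying coefficient -/
noncomputable def atCoef (τ u1 q : ℂ) (p : ℕ) : ℂ := (u1 - cn τ p 1) - q⁻¹ * (1 - cn τ p 0)

lemma disc_eq {τ q : ℂ} (hq : q ≠ 0) (hτ : τ = q + q⁻¹) : τ^2 - 4 = (q⁻¹ - q)^2 := by
  subst hτ; field_simp; ring

lemma cn_rec {τ : ℂ} (h4 : τ^2 - 4 ≠ 0) (p n : ℕ) :
    cn τ p (n+2) = τ * cn τ p (n+1) - cn τ p n - (if (n+1+p) % 2 = 1 then 1 else 0) := by
  unfold cn
  by_cases h : (n + p) % 2 = 0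
  · have h1 : ¬ (n + 1 + p) % 2 = 0 := by omega
    have h2 : (n + 2 + p) % 2 = 0 := by omega
    have h3 : (n + 1 + p) % 2 = 1 := by omega
    rw [if_pos h, if_neg h1, if_pos h2, if_pos h3]
    field_simp; ring
  · have h1 : (n + 1 + p) % 2 = 0 := by omega
    have h2 : ¬ (n + 2 + p) % 2 = 0 := by omega
    have h3 : ¬ (n + 1 + p) % 2 = 1 := by omega
    rw [if_neg h, if_pos h1, if_neg h2, if_neg h3]
    field_simp; ring

lemma sq_closed {τ u1 q : ℂ} {p : ℕ} (hq : q ≠ 0) (hq1 : q⁻¹ - q ≠ 0) (hτ : τ = q + q⁻¹) (n : ℕ) :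
    (q⁻¹ - q) * (sq τ u1 p n - cn τ p n) =
      bt τ u1 q p * (q⁻¹)^n - atCoef τ u1 q p * q^n := by
  have h4 : τ^2 - 4 ≠ 0 := by rw [disc_eq hq hτ]; exact pow_ne_zero _ hq1
  have hqq : q * q⁻¹ = 1 := mul_inv_cancel₀ hq
  induction n using Nat.strong_induction_on with
  | _ n ih =>
    match n with
    | 0 => simp only [sq, bt, atCoef, pow_zero]; ring
    | 1 => simp only [sq, bt, atCoef, pow_one]; linear_combination (0:ℂ) * hqq
    | n+2 =>
      have i1 := ih (n+1) (by omega)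
      have i0 := ih n (by omega)
      rw [sq, cn_rec h4]
      have : (q⁻¹ - q) * (τ * sq τ u1 p (n+1) - sq τ u1 p n - (if (n+1+p) % 2 = 1 then 1 else 0)
        - (τ * cn τ p (n+1) - cn τ p n - (if (n+1+p) % 2 = 1 then 1 else 0))) =
        τ * ((q⁻¹ - q) * (sq τ u1 p (n+1) - cn τ p (n+1)))
          - (q⁻¹ - q) * (sq τ u1 p n - cn τ p n) := by ring
      rw [this, i1, i0, hτ]
      generalize bt (q + q⁻¹) u1 q p = B
      generalize atCoef (q + q⁻¹) u1 q p = A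
      rw [pow_succ q⁻¹ (n+1), pow_succ q⁻¹ n, pow_succ q (n+1), pow_succ q n]
      linear_combination (B * q⁻¹^n - A * q^n) * hqq

lemma bt_mul_at {τ u1 q : ℂ} {p : ℕ} (hq : q ≠ 0) (hq1 : q⁻¹ - q ≠ 0) (hτ : τ = q + q⁻¹)
    (h0 : if p % 2 = 0 then con τ 1 u1 = 0 else con τ u1 1 = 0) :
    bt τ u1 q p * atCoef τ u1 q p * (τ^2 - 4) = -(τ^2 - 3) := by
  have h4 : τ^2 - 4 ≠ 0 := by rw [disc_eq hq hτ]; exact pow_ne_zero _ hq1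
  have hqq : q * q⁻¹ = 1 := mul_inv_cancel₀ hq
  have key : ∀ d0 d1 : ℂ, (d1 - q * d0) * (d1 - q⁻¹ * d0) = d1^2 + d0^2 - τ * d0 * d1 := by
    intro d0 d1; rw [hτ]; linear_combination d0^2 * hqq
  unfold bt atCoef
  rw [key]
  unfold con cn at *
  by_cases h : p % 2 = 0
  · have h1 : ¬ (1 + p) % 2 = 0 := by omega
    rw [if_pos h] at h0
    simp only [zero_add, if_pos h, if_neg h1]
    field_simp
    linear_combination (τ^2-4)^2 * h0
  · have h1 : (1 + p) % 2 = 0 := by omega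
    rw [if_neg h] at h0
    simp only [zero_add, if_neg h, if_pos h1]
    field_simp
    linear_combination (τ^2-4)^2 * h0

lemma sq_differentiableAt {τ u1 : ℂ → ℂ} {p : ℕ} {y : ℂ} (hτ : DifferentiableAt ℂ τ y)
    (hu : DifferentiableAt ℂ u1 y) (n : ℕ) :
    DifferentiableAt ℂ (fun y => sq (τ y) (u1 y) p n) y := by
  induction n using Nat.strong_induction_on with
  | _ n ih =>
    match n with
    | 0 => simp [sq]
    | 1 => simpa [sq] using hu
    | n+2 =>
      simp only [sq]
      exact ((hτ.mul (ih (n+1) (by omega))).sub (ih n (by omega))).sub_const _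

lemma sq_analyticAt {τ u1 : ℂ → ℂ} {p : ℕ} {y : ℂ} (hτ : AnalyticAt ℂ τ y)
    (hu : AnalyticAt ℂ u1 y) (n : ℕ) :
    AnalyticAt ℂ (fun y => sq (τ y) (u1 y) p n) y := by
  induction n using Nat.strong_induction_on with
  | _ n ih =>
    match n with
    | 0 => simp only [sq]; exact analyticAt_const
    | 1 => simpa [sq] using hu
    | n+2 =>
      simp only [sq]
      exact ((hτ.mul (ih (n+1) (by omega))).sub (ih n (by omega))).sub analyticAt_const

/-- Local decomposition: finite head plus analytic tail. -/
theorem SS_local {τ u1 q : ℂ → ℂ} {p : ℕ} {y₀ : ℂ} (hτ : AnalyticAt ℂ τ y₀)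
    (hu : AnalyticAt ℂ u1 y₀) (hq : AnalyticAt ℂ q y₀) (hq0 : q y₀ ≠ 0) (hq1 : ‖q y₀‖ < 1)
    (hτq : ∀ᶠ y in 𝓝 y₀, τ y = q y + (q y)⁻¹) (h3 : (τ y₀)^2 ≠ 3)
    (h0 : if p % 2 = 0 then con (τ y₀) 1 (u1 y₀) = 0 else con (τ y₀) (u1 y₀) 1 = 0) :
    ∃ N, ∃ T : ℂ → ℂ, AnalyticAt ℂ T y₀ ∧ ∀ᶠ y in 𝓝 y₀,
      (∀ n, N ≤ n → sq (τ y) (u1 y) p n ≠ 0) ∧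
      SS (τ y) (u1 y) p = ∑ n ∈ range N, (-1)^n / (sq (τ y) (u1 y) p n * sq (τ y) (u1 y) p (n+1))
        + T y := by
  have hqinv : (q y₀)⁻¹ - q y₀ ≠ 0 := by
    intro h
    have h1 : 1 < ‖(q y₀)⁻¹‖ := by
      rw [norm_inv]; exact (one_lt_inv₀ (norm_pos_iff.2 hq0)).2 hq1
    rw [sub_eq_zero.1 h] at h1
    linarith
  have h4 : (τ y₀)^2 - 4 ≠ 0 := by
    rw [disc_eq hq0 hτq.self_of_nhds]; exact pow_ne_zero _ hqinv
  have hb0 : bt (τ y₀) (u1 y₀) (q y₀) p ≠ 0 := by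
    intro h
    have := bt_mul_at hq0 hqinv hτq.self_of_nhds h0
    rw [h, zero_mul, zero_mul] at this
    exact h3 (by linear_combination this)
  have cτ := hτ.continuousAt
  have cu := hu.continuousAt
  have cq := hq.continuousAt
  have ccn : ∀ n, ContinuousAt (fun y => cn (τ y) p n) y₀ := by
    intro n
    unfold cn
    split_ifs
    · exact continuousAt_const.div ((cτ.pow 2).sub continuousAt_const) h4
    · exact cτ.div ((cτ.pow 2).sub continuousAt_const) h4
  have cqi : ContinuousAt (fun y => (q y)⁻¹) y₀ := cq.inv₀ hq0
  have cd : ContinuousAt (fun y => (q y)⁻¹ - q y) y₀ := cqi.sub cq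
  have cK : ContinuousAt (fun y => bt (τ y) (u1 y) (q y) p / ((q y)⁻¹ - q y)) y₀ :=
    ((cu.sub (ccn 1)).sub (cq.mul (continuousAt_const.sub (ccn 0)))).div cd hqinv
  have cJ : ContinuousAt (fun y => ‖atCoef (τ y) (u1 y) (q y) p / ((q y)⁻¹ - q y)‖
      + ‖cn (τ y) p 0‖ + ‖cn (τ y) p 1‖) y₀ :=
    ((((cu.sub (ccn 1)).sub (cqi.mul (continuousAt_const.sub (ccn 0)))).div cd hqinv).norm.add
      (ccn 0).norm).add (ccn 1).norm
  obtain ⟨ρ, hρ1, hρ2⟩ := exists_between hq1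
  have hρ0 : 0 < ρ := (norm_nonneg _).trans_lt hρ1
  set m : ℝ := ‖bt (τ y₀) (u1 y₀) (q y₀) p / ((q y₀)⁻¹ - q y₀)‖ / 2 with hm
  have hm0 : 0 < m := by
    rw [hm]; exact half_pos (norm_pos_iff.2 (div_ne_zero hb0 hqinv))
  set M : ℝ := ‖atCoef (τ y₀) (u1 y₀) (q y₀) p / ((q y₀)⁻¹ - q y₀)‖
      + ‖cn (τ y₀) p 0‖ + ‖cn (τ y₀) p 1‖ + 1 with hM
  have hM0 : 0 < M := by positivity
  have ev : ∀ᶠ y in 𝓝 y₀, ‖q y‖ < ρ ∧ q y ≠ 0 ∧ (q y)⁻¹ - q y ≠ 0 ∧ τ y = q y + (q y)⁻¹ ∧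
      m < ‖bt (τ y) (u1 y) (q y) p / ((q y)⁻¹ - q y)‖ ∧
      ‖atCoef (τ y) (u1 y) (q y) p / ((q y)⁻¹ - q y)‖ + ‖cn (τ y) p 0‖ + ‖cn (τ y) p 1‖ < M ∧
      AnalyticAt ℂ τ y ∧ AnalyticAt ℂ u1 y := by
    filter_upwards [cq.norm.eventually_lt_const hρ1, cq.eventually_ne hq0, cd.eventually_ne hqinv, hτq,
      cK.norm.eventually_const_lt (u := m) (by rw [hm]; linarith),
      cJ.eventually_lt_const (u := M) (by rw [hM]; linarith),
      hτ.eventually_analyticAt, hu.eventually_analyticAt] with y a1 a2 a3 a4 a5 a6 a7 a8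
    exact ⟨a1, a2, a3, a4, a5, a6, a7, a8⟩
  obtain ⟨δ, hδ, hball⟩ := Metric.eventually_nhds_iff_ball.1 ev
  obtain ⟨N, hN⟩ : ∃ N : ℕ, ρ ^ N < m / (2 * M) :=
    exists_pow_lt_of_lt_one (by positivity) hρ2
  have low : ∀ y ∈ Metric.ball y₀ δ, ∀ n, N ≤ n → m / 2 * (ρ⁻¹)^n ≤ ‖sq (τ y) (u1 y) p n‖ := by
    intro y hy n hn
    obtain ⟨a1, a2, a3, a4, a5, a6, a7, a8⟩ := hball y hy
    have hcl := sq_closed (u1 := u1 y) (p := p) a2 a3 a4 n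
    have e : sq (τ y) (u1 y) p n = bt (τ y) (u1 y) (q y) p / ((q y)⁻¹ - q y) * ((q y)⁻¹)^n
        - (atCoef (τ y) (u1 y) (q y) p / ((q y)⁻¹ - q y) * (q y)^n - cn (τ y) p n) := by
      have gen : ∀ d s c B X A Y : ℂ, d ≠ 0 → d * (s - c) = B * X - A * Y →
          s = B / d * X - (A / d * Y - c) := by
        intro d s c B X A Y hd h
        field_simp
        linear_combination h
      exact gen _ _ _ _ _ _ _ a3 hcl
    have hc : ‖cn (τ y) p n‖ ≤ ‖cn (τ y) p 0‖ + ‖cn (τ y) p 1‖ := by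
      have : cn (τ y) p n = cn (τ y) p 0 ∨ cn (τ y) p n = cn (τ y) p 1 := by
        unfold cn
        rcases Nat.mod_two_eq_zero_or_one n with h | h
        · left; congr 1; rw [eq_iff_iff]; omega
        · right; congr 1; rw [eq_iff_iff]; omega
      rcases this with h | h <;> rw [h] <;> simp
    have hJ : ‖atCoef (τ y) (u1 y) (q y) p / ((q y)⁻¹ - q y) * (q y)^n‖
        ≤ ‖atCoef (τ y) (u1 y) (q y) p / ((q y)⁻¹ - q y)‖ := by
      rw [norm_mul, norm_pow]
      exact mul_le_of_le_one_right (norm_nonneg _)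
        (pow_le_one₀ (norm_nonneg _) (a1.trans hρ2).le)
    have hK : m * (ρ⁻¹)^n ≤ ‖bt (τ y) (u1 y) (q y) p / ((q y)⁻¹ - q y) * ((q y)⁻¹)^n‖ := by
      rw [norm_mul, norm_pow, norm_inv]
      have : ρ⁻¹ ≤ ‖q y‖⁻¹ := inv_anti₀ (norm_pos_iff.2 a2) a1.le
      gcongr
    have hMn : M ≤ m / 2 * (ρ⁻¹)^n := by
      have h1 : ρ ^ n ≤ ρ ^ N := pow_le_pow_of_le_one hρ0.le hρ2.le hn
      have h2 : ρ ^ n < m / (2 * M) := h1.trans_lt hN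
      rw [inv_pow, ← div_eq_mul_inv, le_div_iff₀ (by positivity)]
      rw [lt_div_iff₀ (by positivity)] at h2
      linarith
    rw [e]
    have t1 := norm_sub_norm_le (bt (τ y) (u1 y) (q y) p / ((q y)⁻¹ - q y) * ((q y)⁻¹)^n)
      (atCoef (τ y) (u1 y) (q y) p / ((q y)⁻¹ - q y) * (q y)^n - cn (τ y) p n)
    have t2 := norm_sub_le (atCoef (τ y) (u1 y) (q y) p / ((q y)⁻¹ - q y) * (q y)^n) (cn (τ y) p n)
    linarith
  have hlow1 : ∀ n : ℕ, 1 ≤ (ρ⁻¹)^n := fun n => one_le_pow₀ ((one_le_inv₀ hρ0).2 hρ2.le)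
  have hne : ∀ y ∈ Metric.ball y₀ δ, ∀ n, N ≤ n → sq (τ y) (u1 y) p n ≠ 0 := by
    intro y hy n hn h
    have := low y hy n hn
    rw [h, norm_zero] at this
    have : 0 < m / 2 * (ρ⁻¹)^n := by positivity
    linarith
  have hbound : ∀ (k : ℕ), ∀ y ∈ Metric.ball y₀ δ,
      ‖(-1)^(k+N) / (sq (τ y) (u1 y) p (k+N) * sq (τ y) (u1 y) p (k+N+1))‖ ≤ 4 / m^2 * ρ^k := by
    intro k y hy
    have l1 := low y hy (k+N) (by omega)
    have l2 := low y hy (k+N+1) (by omega)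
    have l2' : m / 2 ≤ ‖sq (τ y) (u1 y) p (k+N+1)‖ := by
      have := hlow1 (k+N+1); nlinarith
    have l1' : m / 2 * (ρ⁻¹)^k ≤ ‖sq (τ y) (u1 y) p (k+N)‖ := by
      refine le_trans ?_ l1
      rw [pow_add]
      have := hlow1 N
      have h5 : 0 < (ρ⁻¹)^k := by positivity
      have : (ρ⁻¹)^k ≤ (ρ⁻¹)^k * (ρ⁻¹)^N := le_mul_of_one_le_right h5.le this
      gcongr
    rw [norm_div, norm_pow, norm_neg, norm_one, one_pow, norm_mul]
    have : 0 < (ρ⁻¹)^k := by positivity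
    calc 1 / (‖sq (τ y) (u1 y) p (k+N)‖ * ‖sq (τ y) (u1 y) p (k+N+1)‖)
        ≤ 1 / ((m / 2 * (ρ⁻¹)^k) * (m/2)) := by
          apply one_div_le_one_div_of_le (by positivity)
          gcongr
      _ = 4 / m^2 * ρ^k := by
          rw [inv_pow]; field_simp; norm_num
  have hsumm : Summable (fun k : ℕ => 4 / m^2 * ρ^k) :=
    (summable_geometric_of_lt_one hρ0.le hρ2).mul_left _
  refine ⟨N, fun y => ∑' k : ℕ, (-1)^(k+N) / (sq (τ y) (u1 y) p (k+N) * sq (τ y) (u1 y) p (k+N+1)),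
    ?_, ?_⟩
  · have hd : DifferentiableOn ℂ (fun y => ∑' k : ℕ,
        (-1)^(k+N) / (sq (τ y) (u1 y) p (k+N) * sq (τ y) (u1 y) p (k+N+1))) (Metric.ball y₀ δ) := by
      refine Complex.differentiableOn_tsum_of_summable_norm hsumm ?_ Metric.isOpen_ball hbound
      intro k y hy
      obtain ⟨a1, a2, a3, a4, a5, a6, a7, a8⟩ := hball y hy
      refine DifferentiableAt.differentiableWithinAt ?_
      refine (differentiableAt_const _).fun_div
        ((sq_differentiableAt a7.differentiableAt a8.differentiableAt _).mul
          (sq_differentiableAt a7.differentiableAt a8.differentiableAt _)) ?_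
      exact mul_ne_zero (hne y hy _ (by omega)) (hne y hy _ (by omega))
    exact hd.analyticAt (Metric.ball_mem_nhds _ hδ)
  · filter_upwards [Metric.ball_mem_nhds y₀ hδ] with y hy
    refine ⟨hne y hy, ?_⟩
    unfold SS
    refine (Summable.sum_add_tsum_nat_add N ?_).symm
    rw [← summable_nat_add_iff N]
    exact Summable.of_norm_bounded hsumm fun k => hbound k y hy

theorem SS_meromorphicAt {τ u1 q : ℂ → ℂ} {p : ℕ} {y₀ : ℂ} (hτ : AnalyticAt ℂ τ y₀)
    (hu : AnalyticAt ℂ u1 y₀) (hq : AnalyticAt ℂ q y₀) (hq0 : q y₀ ≠ 0) (hq1 : ‖q y₀‖ < 1)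
    (hτq : ∀ᶠ y in 𝓝 y₀, τ y = q y + (q y)⁻¹) (h3 : (τ y₀)^2 ≠ 3)
    (h0 : if p % 2 = 0 then con (τ y₀) 1 (u1 y₀) = 0 else con (τ y₀) (u1 y₀) 1 = 0) :
    MeromorphicAt (fun y => SS (τ y) (u1 y) p) y₀ := by
  obtain ⟨N, T, hT, hev⟩ := SS_local hτ hu hq hq0 hq1 hτq h3 h0
  have : MeromorphicAt (fun y => ∑ n ∈ range N,
      (-1)^n / (sq (τ y) (u1 y) p n * sq (τ y) (u1 y) p (n+1)) + T y) y₀ := by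
    refine MeromorphicAt.fun_add (MeromorphicAt.fun_sum fun n _ => ?_) hT.meromorphicAt
    exact analyticAt_const.meromorphicAt.fun_div
      ((sq_analyticAt hτ hu n).meromorphicAt.fun_mul (sq_analyticAt hτ hu (n+1)).meromorphicAt)
  refine this.congr ?_
  refine Filter.Eventually.filter_mono nhdsWithin_le_nhds ?_
  filter_upwards [hev] with y hy using hy.2.symm

theorem SS_analyticAt {τ u1 q : ℂ → ℂ} {p : ℕ} {y₀ : ℂ} (hτ : AnalyticAt ℂ τ y₀)
    (hu : AnalyticAt ℂ u1 y₀) (hq : AnalyticAt ℂ q y₀) (hq0 : q y₀ ≠ 0) (hq1 : ‖q y₀‖ < 1)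
    (hτq : ∀ᶠ y in 𝓝 y₀, τ y = q y + (q y)⁻¹) (h3 : (τ y₀)^2 ≠ 3)
    (h0 : if p % 2 = 0 then con (τ y₀) 1 (u1 y₀) = 0 else con (τ y₀) (u1 y₀) 1 = 0)
    (hne : ∀ n, sq (τ y₀) (u1 y₀) p n ≠ 0) :
    AnalyticAt ℂ (fun y => SS (τ y) (u1 y) p) y₀ := by
  obtain ⟨N, T, hT, hev⟩ := SS_local hτ hu hq hq0 hq1 hτq h3 h0
  have : AnalyticAt ℂ (fun y => ∑ n ∈ range N,
      (-1)^n / (sq (τ y) (u1 y) p n * sq (τ y) (u1 y) p (n+1)) + T y) y₀ := by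
    refine AnalyticAt.fun_add (Finset.analyticAt_fun_sum _ fun n _ => ?_) hT
    exact analyticAt_const.fun_div
      ((sq_analyticAt hτ hu n).fun_mul (sq_analyticAt hτ hu (n+1))) (mul_ne_zero (hne _) (hne _))
  refine this.congr ?_
  filter_upwards [hev] with y hy using hy.2.symm

end ModelE

namespace ModelE
open Finset Filter Topology

/-- square root -/
noncomputable def rt (a : ℂ) : ℂ := Complex.exp (Complex.log a / 2)

lemma rt_sq {a : ℂ} (ha : a ≠ 0) : rt a ^ 2 = a := by
  unfold rt
  rw [← Complex.exp_nat_mul]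
  convert Complex.exp_log ha using 2
  push_cast; ring

lemma rt_re {a : ℂ} (ha : a ∈ Complex.slitPlane) : 0 < (rt a).re := by
  unfold rt
  rw [Complex.exp_re]
  refine mul_pos (Real.exp_pos _) ?_
  have h1 : (Complex.log a / 2).im = a.arg / 2 := by
    rw [show (2:ℂ) = ((2:ℝ):ℂ) by norm_num, Complex.div_ofReal_im, Complex.log_im]
  rw [h1]
  have h2 := Complex.neg_pi_lt_arg a
  have h3 := Complex.arg_le_pi a
  have h4 := Complex.mem_slitPlane_iff_arg.1 ha
  have h5 : a.arg < Real.pi := lt_of_le_of_ne h3 h4.1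
  exact Real.cos_pos_of_mem_Ioo ⟨by linarith, by linarith⟩

lemma rt_analyticAt {a : ℂ} (ha : a ∈ Complex.slitPlane) : AnalyticAt ℂ rt a := by
  unfold rt
  have : AnalyticAt ℂ Complex.log a := analyticAt_clog ha
  fun_prop (disch := norm_num)

lemma rt_cmp {a b : ℂ} (ha : a ∈ Complex.slitPlane) (hb : b ∈ Complex.slitPlane)
    (him : a.im = b.im) : ‖rt a - rt b‖ < ‖rt a + rt b‖ := by
  have xa := rt_re ha
  have xb := rt_re hb
  have sa := congrArg Complex.im (rt_sq (Complex.slitPlane_ne_zero ha))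
  have sb := congrArg Complex.im (rt_sq (Complex.slitPlane_ne_zero hb))
  rw [pow_two, Complex.mul_im] at sa sb
  have hpos : 0 ≤ (rt a).im * (rt b).im := by
    have h : 4 * ((rt a).re * (rt b).re) * ((rt a).im * (rt b).im) = a.im ^ 2 := by
      rw [pow_two]; nth_rewrite 2 [him]; rw [← sa, ← sb]; ring
    by_contra hneg
    push Not at hneg
    have : 0 < (rt a).re * (rt b).re := mul_pos xa xb
    nlinarith [sq_nonneg a.im]
  rw [← sq_lt_sq₀ (norm_nonneg _) (norm_nonneg _), ← Complex.normSq_eq_norm_sq,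
    ← Complex.normSq_eq_norm_sq, Complex.normSq_apply, Complex.normSq_apply]
  simp only [Complex.sub_re, Complex.sub_im, Complex.add_re, Complex.add_im]
  nlinarith [mul_pos xa xb]

/-- the inverse parameter -/
noncomputable def tu (y : ℂ) : ℂ := y + 3 / y
/-- small root -/
noncomputable def qf (y : ℂ) : ℂ := -((rt (2 - tu y) - rt (-2 - tu y)) / 2)^2
/-- large root of the v equation -/
noncomputable def vf (y : ℂ) : ℂ :=
  -((rt (((2 * √2 + 1 : ℝ) : ℂ) - tu y) + rt (((-(2 * √2) + 1 : ℝ) : ℂ) - tu y)) / 2)^2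
/-- the domain -/
def Om : Set ℂ := ({y | 0 < y.im ∧ ‖y‖ < √3} ∪ {y | 0 < y.im ∧ y.re < -1}) ∪ {y | √3 < y.im}

lemma s3 : (1:ℝ) < √3 := by
  rw [Real.lt_sqrt] <;> norm_num
lemma s3' : √3 < (2:ℝ) := by
  rw [Real.sqrt_lt'] <;> norm_num
lemma s2 : √2 < (3/2:ℝ) := by
  rw [Real.sqrt_lt'] <;> norm_num

lemma Om_open : IsOpen Om := by
  unfold Om
  refine IsOpen.union (IsOpen.union ?_ ?_) ?_
  · exact (isOpen_lt continuous_const Complex.continuous_im).inter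
      (isOpen_lt continuous_norm continuous_const)
  · exact (isOpen_lt continuous_const Complex.continuous_im).inter
      (isOpen_lt Complex.continuous_re continuous_const)
  · exact isOpen_lt continuous_const Complex.continuous_im

lemma Om_conn : IsPreconnected Om := by
  unfold Om
  have c1 : Convex ℝ {y : ℂ | 0 < y.im ∧ ‖y‖ < √3} := by
    have : {y : ℂ | 0 < y.im ∧ ‖y‖ < √3} = {y : ℂ | 0 < y.im} ∩ Metric.ball 0 √3 := by
      ext y; simp
    rw [this]
    exact (convex_halfSpace_im_gt 0).inter (convex_ball _ _)
  have c2 : Convex ℝ {y : ℂ | 0 < y.im ∧ y.re < -1} :=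
    (convex_halfSpace_im_gt 0).inter (convex_halfSpace_re_lt _)
  have c3 : Convex ℝ {y : ℂ | √3 < y.im} := convex_halfSpace_im_gt _
  refine IsPreconnected.union' ?_ (IsPreconnected.union' ?_ c1.isPreconnected c2.isPreconnected)
    c3.isPreconnected
  · exact ⟨⟨-2, 2⟩, Or.inr ⟨by norm_num, by norm_num⟩, by simpa using s3'⟩
  · refine ⟨⟨-11/10, 1/10⟩, ⟨by norm_num, ?_⟩, ⟨by norm_num, by norm_num⟩⟩
    rw [Complex.norm_eq_sqrt_sq_add_sq]; exact Real.sqrt_lt_sqrt (by positivity) (by norm_num)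


lemma Om_im {y : ℂ} (hy : y ∈ Om) : 0 < y.im := by
  rcases hy with (h | h) | h
  · exact h.1
  · exact h.1
  · exact lt_trans (by linarith [s3]) h

lemma Om_ne {y : ℂ} (hy : y ∈ Om) : y ≠ 0 := by
  intro h; have := Om_im hy; rw [h] at this; simp at this

lemma tu_im (y : ℂ) : (tu y).im = y.im * (1 - 3 / ‖y‖^2) := by
  unfold tu
  rw [Complex.add_im, Complex.div_im, Complex.normSq_eq_norm_sq]
  simp; ring

lemma tu_re (y : ℂ) : (tu y).re = y.re * (1 + 3 / ‖y‖^2) := by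
  unfold tu
  rw [Complex.add_re, Complex.div_re, Complex.normSq_eq_norm_sq]
  simp; ring

lemma Om_good {y : ℂ} (hy : y ∈ Om) : (tu y).im ≠ 0 ∨ (tu y).re < -2 := by
  have h0 := Om_ne hy
  have hn : 0 < ‖y‖ := norm_pos_iff.2 h0
  have him := Om_im hy
  by_cases h3 : ‖y‖^2 = 3
  · right
    have hn3 : ‖y‖ = √3 := by rw [← h3, Real.sqrt_sq hn.le]
    rw [tu_re, h3]
    rcases hy with (h | h) | h
    · exact absurd h.2 (by rw [hn3]; exact lt_irrefl _)
    · have := h.2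
      linarith
    · have h1 : √3 < y.im := h
      have h2 := Complex.abs_im_le_norm y
      have h3 := le_abs_self y.im
      linarith
  · left
    rw [tu_im]
    refine mul_ne_zero him.ne' ?_
    intro h
    apply h3
    field_simp at h
    linarith

lemma good_slit {τ : ℂ} (h : τ.im ≠ 0 ∨ τ.re < -2) {c : ℝ} (hc : -2 ≤ c) :
    (c : ℂ) - τ ∈ Complex.slitPlane := by
  rw [Complex.mem_slitPlane_iff]
  rcases h with h | h
  · right; simpa using h
  · left; simp; linarith

lemma Om_ne_real {y : ℂ} (hy : y ∈ Om) {c : ℝ} (hc : -2 ≤ c) : tu y ≠ c := by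
  intro h
  have := Om_good hy
  rw [h] at this
  simp at this
  linarith

lemma tu_analyticAt {y : ℂ} (hy : y ≠ 0) : AnalyticAt ℂ tu y := by
  unfold tu
  exact analyticAt_id.fun_add (analyticAt_const.fun_div analyticAt_id hy)

lemma slit2 {y : ℂ} (hy : y ∈ Om) : 2 - tu y ∈ Complex.slitPlane := by
  simpa using good_slit (Om_good hy) (c := 2) (by norm_num)
lemma slitm2 {y : ℂ} (hy : y ∈ Om) : -2 - tu y ∈ Complex.slitPlane := by
  simpa using good_slit (Om_good hy) (c := -2) (by norm_num)
lemma slita {y : ℂ} (hy : y ∈ Om) : ((2 * √2 + 1 : ℝ) : ℂ) - tu y ∈ Complex.slitPlane :=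
  good_slit (Om_good hy) (by have := Real.sqrt_nonneg 2; linarith)
lemma slitb {y : ℂ} (hy : y ∈ Om) : ((-(2 * √2) + 1 : ℝ) : ℂ) - tu y ∈ Complex.slitPlane :=
  good_slit (Om_good hy) (by linarith [s2])

lemma qf_analyticAt {y : ℂ} (hy : y ∈ Om) : AnalyticAt ℂ qf y := by
  unfold qf
  have h1 := tu_analyticAt (Om_ne hy)
  have h2 : AnalyticAt ℂ (fun y => rt (2 - tu y)) y :=
    AnalyticAt.fun_comp (g := rt) (rt_analyticAt (slit2 hy)) (analyticAt_const.fun_sub h1)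
  have h3 : AnalyticAt ℂ (fun y => rt (-2 - tu y)) y :=
    AnalyticAt.fun_comp (g := rt) (rt_analyticAt (slitm2 hy)) (analyticAt_const.fun_sub h1)
  exact (((h2.fun_sub h3).fun_div analyticAt_const (by norm_num)).fun_pow 2).fun_neg

lemma vf_analyticAt {y : ℂ} (hy : y ∈ Om) : AnalyticAt ℂ vf y := by
  unfold vf
  have h1 := tu_analyticAt (Om_ne hy)
  have h2 : AnalyticAt ℂ (fun y => rt (((2 * √2 + 1 : ℝ) : ℂ) - tu y)) y :=
    AnalyticAt.fun_comp (g := rt) (rt_analyticAt (slita hy)) (analyticAt_const.fun_sub h1)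
  have h3 : AnalyticAt ℂ (fun y => rt (((-(2 * √2) + 1 : ℝ) : ℂ) - tu y)) y :=
    AnalyticAt.fun_comp (g := rt) (rt_analyticAt (slitb hy)) (analyticAt_const.fun_sub h1)
  exact (((h2.fun_add h3).fun_div analyticAt_const (by norm_num)).fun_pow 2).fun_neg

lemma qf_spec {y : ℂ} (hy : y ∈ Om) : qf y ≠ 0 ∧ ‖qf y‖ < 1 ∧ tu y = qf y + (qf y)⁻¹ := by
  have e1 := rt_sq (Complex.slitPlane_ne_zero (slit2 hy))
  have e2 := rt_sq (Complex.slitPlane_ne_zero (slitm2 hy))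
  have hlt := rt_cmp (slit2 hy) (slitm2 hy) (by simp)
  unfold qf
  set s := rt (2 - tu y)
  set r := rt (-2 - tu y)
  have hprod : (-((s - r) / 2)^2) * (-((s + r) / 2)^2) = 1 := by
    have : (-((s - r) / 2)^2) * (-((s + r) / 2)^2) = ((s^2 - r^2) / 4)^2 := by ring
    rw [this, e1, e2]; ring
  have hsum : (-((s - r) / 2)^2) + (-((s + r) / 2)^2) = tu y := by
    have : (-((s - r) / 2)^2) + (-((s + r) / 2)^2) = -(s^2 + r^2) / 2 := by ring
    rw [this, e1, e2]; ring
  refine ⟨left_ne_zero_of_mul_eq_one hprod, ?_, ?_⟩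
  · have hn := congrArg norm hprod
    rw [norm_mul, norm_one] at hn
    simp only [norm_neg, norm_pow, norm_div] at hn ⊢
    have h2 : ‖(2:ℂ)‖ = 2 := by simp
    rw [h2] at hn ⊢
    have p1 := norm_nonneg (s - r)
    by_contra hge
    push Not at hge
    have : (‖s - r‖ / 2)^2 < (‖s + r‖ / 2)^2 := by gcongr
    nlinarith
  · rw [← hsum, eq_inv_of_mul_eq_one_right hprod]

lemma vf_spec {y : ℂ} (hy : y ∈ Om) : 2 < ‖vf y‖^2 ∧ con (tu y) (vf y) 1 = 0 := by
  have e1 := rt_sq (Complex.slitPlane_ne_zero (slita hy))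
  have e2 := rt_sq (Complex.slitPlane_ne_zero (slitb hy))
  have hlt := rt_cmp (slita hy) (slitb hy) (by simp)
  unfold vf
  set s := rt (((2 * √2 + 1 : ℝ) : ℂ) - tu y)
  set r := rt (((-(2 * √2) + 1 : ℝ) : ℂ) - tu y)
  have h22 : ((√2 : ℝ) : ℂ)^2 = 2 := by
    rw [← Complex.ofReal_pow, Real.sq_sqrt (by norm_num)]; norm_num
  have hprod : (-((s - r) / 2)^2) * (-((s + r) / 2)^2) = 2 := by
    have : (-((s - r) / 2)^2) * (-((s + r) / 2)^2) = ((s^2 - r^2) / 4)^2 := by ring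
    rw [this, e1, e2]; push_cast; linear_combination h22
  have hsum : (-((s - r) / 2)^2) + (-((s + r) / 2)^2) = tu y - 1 := by
    have : (-((s - r) / 2)^2) + (-((s + r) / 2)^2) = -(s^2 + r^2) / 2 := by ring
    rw [this, e1, e2]; push_cast; ring
  generalize hw : -((s - r) / 2)^2 = w at *
  have hw' : ‖w‖ < ‖-((s + r) / 2)^2‖ := by
    rw [← hw]
    simp only [norm_neg, norm_pow, norm_div]
    gcongr
    simp
  generalize -((s + r) / 2)^2 = v at *
  constructor
  · have hn := congrArg norm hprod
    rw [norm_mul] at hn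
    have h2 : ‖(2:ℂ)‖ = 2 := by simp
    rw [h2] at hn
    nlinarith [norm_nonneg w]
  · unfold con
    linear_combination v * hsum - hprod

lemma u1_con {y : ℂ} (hy : y ≠ 0) : con (tu y) 1 (3 / y) = 0 := by
  unfold con tu; field_simp; ring

lemma tu_sq_ne {y : ℂ} (hy : y ∈ Om) : (tu y)^2 ≠ 3 := by
  intro h
  have h3 : ((√3 : ℝ) : ℂ)^2 = 3 := by
    rw [← Complex.ofReal_pow, Real.sq_sqrt (by norm_num)]; norm_num
  rw [← h3] at h
  rcases sq_eq_sq_iff_eq_or_eq_neg.1 h with h | h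
  · exact Om_ne_real hy (c := √3) (by linarith [s3]) h
  · exact Om_ne_real hy (c := -√3) (by linarith [s3']) (by simpa using h)

/-- first alternating sum -/
noncomputable def Af (y : ℂ) : ℂ := SS (tu y) (3 / y) 0
/-- second alternating sum -/
noncomputable def Bf (y : ℂ) : ℂ := SS (tu y) (vf y) 1

lemma ev_tu {y : ℂ} (hy : y ∈ Om) : ∀ᶠ z in 𝓝 y, tu z = qf z + (qf z)⁻¹ := by
  filter_upwards [Om_open.mem_nhds hy] with z hz using (qf_spec hz).2.2

lemma Af_mero {y : ℂ} (hy : y ∈ Om) : MeromorphicAt Af y :=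
  SS_meromorphicAt (q := qf) (u1 := fun y => 3 / y) (tu_analyticAt (Om_ne hy))
    (analyticAt_const.fun_div analyticAt_id (Om_ne hy)) (qf_analyticAt hy) (qf_spec hy).1
    (qf_spec hy).2.1 (ev_tu hy) (tu_sq_ne hy) (by simpa using u1_con (Om_ne hy))

lemma Bf_mero {y : ℂ} (hy : y ∈ Om) : MeromorphicAt Bf y :=
  SS_meromorphicAt (q := qf) (u1 := vf) (tu_analyticAt (Om_ne hy))
    (vf_analyticAt hy) (qf_analyticAt hy) (qf_spec hy).1
    (qf_spec hy).2.1 (ev_tu hy) (tu_sq_ne hy) (by simpa using (vf_spec hy).2)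

lemma Bf_analytic {y : ℂ} (hy : y ∈ Om) (hne : ∀ n, sq (tu y) (vf y) 1 n ≠ 0) :
    AnalyticAt ℂ Bf y :=
  SS_analyticAt (q := qf) (u1 := vf) (tu_analyticAt (Om_ne hy))
    (vf_analyticAt hy) (qf_analyticAt hy) (qf_spec hy).1
    (qf_spec hy).2.1 (ev_tu hy) (tu_sq_ne hy) (by simpa using (vf_spec hy).2) hne

lemma Af_local {y₀ : ℂ} (hy : y₀ ∈ Om) :
    ∃ N, ∃ T : ℂ → ℂ, AnalyticAt ℂ T y₀ ∧ ∀ᶠ y in 𝓝 y₀,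
      (∀ n, N ≤ n → sq (tu y) (3 / y) 0 n ≠ 0) ∧
      Af y = ∑ n ∈ range N, (-1)^n / (sq (tu y) (3 / y) 0 n * sq (tu y) (3 / y) 0 (n+1))
        + T y :=
  SS_local (q := qf) (u1 := fun y => 3 / y) (tu_analyticAt (Om_ne hy))
    (analyticAt_const.fun_div analyticAt_id (Om_ne hy)) (qf_analyticAt hy) (qf_spec hy).1
    (qf_spec hy).2.1 (ev_tu hy) (tu_sq_ne hy) (by simpa using u1_con (Om_ne hy))

lemma small_formula {y : ℂ} (him : 0 < y.im) (hy : ‖y‖ < 1/10) :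
    ‖(tu y)⁻¹‖ ≤ 1/8 ∧ (1 - 4 * (tu y)⁻¹) * ∑' n, (quarterPlaneWalks SE n : ℂ) * (tu y)⁻¹^n
      = 1 - Af y - Bf y := by
  have hO : y ∈ Om := Or.inl (Or.inl ⟨him, by linarith [s3]⟩)
  have h0 := Om_ne hO
  have hn : 0 < ‖y‖ := norm_pos_iff.2 h0
  have h30 : 30 ≤ ‖3 / y‖ := by
    rw [norm_div, le_div_iff₀ hn]; simp; linarith
  have ht : 29 ≤ ‖tu y‖ := by
    have : 3 / y = tu y - y := by unfold tu; ring
    rw [this] at h30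
    have := norm_sub_le (tu y) y
    linarith
  have ht0 : tu y ≠ 0 := by rw [← norm_pos_iff]; linarith
  have hinv : ‖(tu y)⁻¹‖ ≤ 1/8 := by
    rw [norm_inv, one_div]; exact inv_anti₀ (by norm_num) (by linarith)
  refine ⟨hinv, E_formula hinv (inv_mul_cancel₀ ht0) (by linarith) ?_ (u1_con h0) (vf_spec hO).2⟩
  obtain ⟨h1, h2⟩ := vf_spec hO
  have hv1 : 1 ≤ ‖vf y‖ := by nlinarith [norm_nonneg (vf y)]
  have hv0 : vf y ≠ 0 := by rw [← norm_pos_iff]; linarith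
  have e : tu y = vf y + 1 + 2 / vf y := by
    unfold con at h2; field_simp; linear_combination -h2
  have h3 := norm_add_le (vf y + 1) (2 / vf y)
  have h4 := norm_add_le (vf y) 1
  have h5 : ‖2 / vf y‖ ≤ 2 := by
    rw [norm_div]; simp; exact div_le_self (by norm_num) hv1
  rw [← e] at h3
  rw [norm_one] at h4
  linarith

end ModelE

namespace ModelE
open Finset Filter Topology

/-- the quantity W -/
noncomputable def wr (ε : ℝ) : ℝ := √(Real.cosh ε ^ 2 + 2)
/-- point on the imaginary axis -/
noncomputable def yy (ε : ℝ) : ℂ := Complex.I * ((Real.sinh ε + wr ε : ℝ) : ℂ)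
/-- even numerators -/
noncomputable def ge (m : ℕ) (ε : ℝ) : ℝ :=
  (2 * Real.cosh ε ^ 2 + 1) * Real.cosh (2 * m * ε)
    - 2 * Real.cosh ε * wr ε * Real.sinh (2 * m * ε) - (-1)^m
/-- odd numerators -/
noncomputable def go (m : ℕ) (ε : ℝ) : ℝ :=
  (2 * Real.cosh ε ^ 2 + 1) * Real.sinh ((2 * m + 1) * ε)
    - 2 * Real.cosh ε * wr ε * Real.cosh ((2 * m + 1) * ε) - (-1)^m * Real.sinh ε

lemma wr_sq (ε : ℝ) : wr ε ^ 2 = Real.cosh ε ^ 2 + 2 := Real.sq_sqrt (by positivity)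

lemma wr_pos (ε : ℝ) : √3 ≤ wr ε :=
  Real.sqrt_le_sqrt (by nlinarith [Real.one_le_cosh ε])

lemma yy_mem {ε : ℝ} (h : 0 < ε) : yy ε ∈ Om := by
  right
  have : (yy ε).im = Real.sinh ε + wr ε := by
    unfold yy
    rw [Complex.I_mul_im, Complex.ofReal_re]
  show √3 < (yy ε).im
  rw [this]
  have := Real.sinh_pos_iff.2 h
  linarith [wr_pos ε]

lemma yy_inv {ε : ℝ} (h : 0 < ε) : 3 / yy ε = Complex.I * ((Real.sinh ε - wr ε : ℝ) : ℂ) := by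
  rw [div_eq_iff (Om_ne (yy_mem h))]
  unfold yy
  have h1 := Real.cosh_sq ε
  have h2 := wr_sq ε
  have : (3 : ℝ) = -((Real.sinh ε - wr ε) * (Real.sinh ε + wr ε)) := by nlinarith
  have h3 : (3:ℂ) = -(((Real.sinh ε - wr ε : ℝ) : ℂ) * ((Real.sinh ε + wr ε : ℝ) : ℂ)) := by
    exact_mod_cast this
  linear_combination h3 - (((Real.sinh ε - wr ε : ℝ) : ℂ) * ((Real.sinh ε + wr ε : ℝ) : ℂ)) * Complex.I_sq

lemma tu_yy {ε : ℝ} (h : 0 < ε) : tu (yy ε) = 2 * Complex.I * (Real.sinh ε : ℂ) := by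
  unfold tu
  rw [yy_inv h]
  unfold yy
  push_cast; ring

lemma ge_rec (m : ℕ) (ε : ℝ) :
    ge (m+1) ε = 2 * Real.sinh ε * go m ε + ge m ε + 2 * Real.cosh ε ^ 2 * (-1)^m := by
  unfold ge go
  have e1 : 2 * ((m + 1 : ℕ) : ℝ) * ε = (2 * m + 1) * ε + ε := by push_cast; ring
  have e2 : 2 * (m : ℝ) * ε = (2 * m + 1) * ε - ε := by ring
  rw [e1, e2, Real.cosh_add, Real.sinh_add, Real.cosh_sub, Real.sinh_sub, pow_succ]
  have := Real.cosh_sq ε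
  linear_combination (-2 * (-1)^m) * this

lemma go_rec (m : ℕ) (ε : ℝ) : go (m+1) ε = 2 * Real.sinh ε * ge (m+1) ε + go m ε := by
  unfold ge go
  have e1 : (2 * ((m + 1 : ℕ) : ℝ) + 1) * ε = 2 * ((m+1:ℕ):ℝ) * ε + ε := by push_cast; ring
  have e2 : (2 * (m : ℝ) + 1) * ε = 2 * ((m+1:ℕ):ℝ) * ε - ε := by push_cast; ring
  rw [e1, e2, Real.cosh_add, Real.sinh_add, Real.cosh_sub, Real.sinh_sub, pow_succ]
  ring

lemma sq_yy {ε : ℝ} (h : 0 < ε) (m : ℕ) :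
    2 * (Real.cosh ε : ℂ) ^ 2 * sq (tu (yy ε)) (3 / yy ε) 0 (2 * m) = (-1)^m * (ge m ε : ℂ) ∧
    2 * (Real.cosh ε : ℂ) ^ 2 * sq (tu (yy ε)) (3 / yy ε) 0 (2 * m + 1)
      = (-1)^m * Complex.I * (go m ε : ℂ) := by
  rw [tu_yy h, yy_inv h]
  induction m with
  | zero =>
    constructor
    · have : (ge 0 ε) = 2 * Real.cosh ε ^ 2 := by simp [ge]
      rw [this]; simp only [sq]; push_cast; ring
    · have : (go 0 ε) = 2 * Real.cosh ε ^ 2 * (Real.sinh ε - wr ε) := by simp [go]; ring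
      rw [this]; simp only [sq]; push_cast; ring
  | succ m ih =>
    obtain ⟨i0, i1⟩ := ih
    have a : 2 * (Real.cosh ε : ℂ) ^ 2 * sq (2 * Complex.I * (Real.sinh ε : ℂ))
        (Complex.I * ((Real.sinh ε - wr ε : ℝ) : ℂ)) 0 (2 * (m+1)) = (-1)^(m+1) * (ge (m+1) ε : ℂ) := by
      rw [show 2 * (m+1) = 2 * m + 2 by ring, sq, if_pos (by omega), ge_rec]
      have hp : ((-1:ℂ)^m)^2 = 1 := by rw [← pow_mul, mul_comm, pow_mul]; simp
      push_cast
      rw [pow_succ]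
      push_cast at i0 i1
      linear_combination (2 * Complex.I * (Complex.sinh ε : ℂ)) * i1 - i0 +
        (2 * Complex.sinh ε * (-1)^m * go m ε) * Complex.I_sq + 2 * Complex.cosh ε ^2 * hp
    refine ⟨a, ?_⟩
    rw [show 2 * (m+1) + 1 = (2 * m + 1) + 2 by ring, sq, if_neg (by omega),
      show 2 * m + 1 + 1 = 2 * (m+1) by ring, go_rec]
    rw [pow_succ] at a ⊢
    push_cast at i0 i1 a ⊢
    linear_combination (2 * Complex.I * (Complex.sinh ε : ℂ)) * a - i1

lemma D_pos (ε : ℝ) : 2/5 < 2 * Real.cosh ε * wr ε - (2 * Real.cosh ε ^ 2 + 1) := by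
  have h1 := Real.one_le_cosh ε
  have h2 := wr_sq ε
  have h3 : 0 < wr ε := by linarith [wr_pos ε, s3]
  have h4 : 0 < 2 * Real.cosh ε * wr ε := by positivity
  have h5 : (2 * Real.cosh ε * wr ε)^2 = 4 * Real.cosh ε^2 * (Real.cosh ε ^ 2 + 2) := by
    rw [← h2]; ring
  nlinarith

lemma go_neg {ε : ℝ} (h : 0 < ε) (h1 : Real.sinh ε ≤ 2/5) (m : ℕ) : go m ε < 0 := by
  unfold go
  have hD := D_pos ε
  have hs := Real.sinh_pos_iff.2 h
  have hx := Real.sinh_lt_cosh ((2 * m + 1) * ε)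
  have hc := Real.one_le_cosh ((2 * m + 1) * ε)
  have hm : -(-1:ℝ)^m * Real.sinh ε ≤ Real.sinh ε := by
    rcases neg_one_pow_eq_or ℝ m with e | e <;> rw [e] <;> linarith
  nlinarith [sq_nonneg (Real.cosh ε)]

lemma D_mono {a b : ℝ} (ha : 0 ≤ a) (hab : a < b) :
    2 * Real.cosh a * wr a - (2 * Real.cosh a ^ 2 + 1) ≤
    2 * Real.cosh b * wr b - (2 * Real.cosh b ^ 2 + 1) := by
  have h : Real.cosh a ≤ Real.cosh b := by
    rw [Real.cosh_le_cosh, abs_of_nonneg ha, abs_of_nonneg (by linarith)]; exact hab.le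
  have ca := Real.one_le_cosh a
  have wa := wr_sq a
  have wb := wr_sq b
  have pa : 0 < wr a := by linarith [wr_pos a, s3]
  have pb : 0 < wr b := by linarith [wr_pos b, s3]
  have hwa : Real.cosh a ≤ wr a := by nlinarith
  set p := Real.cosh a
  set r := Real.cosh b
  set u := wr a
  set v := wr b
  have uv : u ≤ v := by nlinarith
  have k1 : (u - p) * (u + p) = 2 := by nlinarith
  have k2 : (v - r) * (v + r) = 2 := by nlinarith
  have k3 : p * v ≤ r * u := by
    have : (p * v)^2 ≤ (r * u)^2 := by
      rw [mul_pow, mul_pow, wa, wb]; nlinarith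
    exact le_of_sq_le_sq this (by positivity)
  have k4 : p * (u - p) ≤ r * (v - r) := by
    have q1 : u - p = 2 / (u + p) := by rw [eq_div_iff (by linarith)]; exact k1
    have q2 : v - r = 2 / (v + r) := by rw [eq_div_iff (by linarith)]; exact k2
    rw [q1, q2, mul_div_assoc', mul_div_assoc', div_le_div_iff₀ (by linarith) (by linarith)]
    nlinarith
  nlinarith

lemma ge_form (m : ℕ) (ε : ℝ) : ge m ε = (Real.exp (-((2 * m - 2) * ε)) / 2
      + Real.exp (-((2 * m + 2) * ε)) / 2 + 2 * Real.exp (-(2 * m * ε)))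
    - (2 * Real.cosh ε * wr ε - (2 * Real.cosh ε ^ 2 + 1)) * Real.sinh (2 * m * ε) - (-1)^m := by
  unfold ge
  have e1 : Real.exp (-((2 * m - 2) * ε)) = Real.exp (-(2 * m * ε)) * Real.exp ε ^2 := by
    rw [← Real.exp_nat_mul, ← Real.exp_add]; congr 1; push_cast; ring
  have e2 : Real.exp (-((2 * m + 2) * ε)) = Real.exp (-(2 * m * ε)) * Real.exp (-ε) ^2 := by
    rw [← Real.exp_nat_mul, ← Real.exp_add]; congr 1; push_cast; ring
  have e3 : Real.exp (-(2 * m * ε)) = Real.cosh (2 * m * ε) - Real.sinh (2 * m * ε) :=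
    (Real.cosh_sub_sinh _).symm
  have e4 : Real.exp ε = Real.cosh ε + Real.sinh ε := (Real.cosh_add_sinh _).symm
  have e5 : Real.exp (-ε) = Real.cosh ε - Real.sinh ε := (Real.cosh_sub_sinh _).symm
  rw [e1, e2, e3, e4, e5]
  have := Real.cosh_sq ε
  linear_combination (Real.cosh (2 * m * ε) - Real.sinh (2 * m * ε)) * this

lemma ge_anti {m : ℕ} (hm : 1 ≤ m) {a b : ℝ} (ha : 0 ≤ a) (hab : a < b) : ge m b < ge m a := by
  rw [ge_form, ge_form]
  have hm' : (1:ℝ) ≤ m := by exact_mod_cast hm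
  have x1 : Real.exp (-((2 * m - 2) * b)) ≤ Real.exp (-((2 * m - 2) * a)) :=
    Real.exp_le_exp.2 (by nlinarith)
  have x2 : Real.exp (-((2 * m + 2) * b)) ≤ Real.exp (-((2 * m + 2) * a)) :=
    Real.exp_le_exp.2 (by nlinarith)
  have x3 : Real.exp (-(2 * m * b)) ≤ Real.exp (-(2 * m * a)) :=
    Real.exp_le_exp.2 (by nlinarith)
  have hD := D_mono ha hab
  have hDa := D_pos a
  have hs : Real.sinh (2 * m * a) < Real.sinh (2 * m * b) := Real.sinh_lt_sinh.2 (by nlinarith)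
  have hs0 : 0 ≤ Real.sinh (2 * m * a) := Real.sinh_nonneg_iff.2 (by positivity)
  have : (2 * Real.cosh a * wr a - (2 * Real.cosh a ^ 2 + 1)) * Real.sinh (2 * m * a) <
      (2 * Real.cosh b * wr b - (2 * Real.cosh b ^ 2 + 1)) * Real.sinh (2 * m * b) := by
    nlinarith
  linarith

lemma wr_cont : Continuous wr := by
  unfold wr
  have := Real.continuous_cosh
  fun_prop

lemma ge_cont (m : ℕ) : Continuous (ge m) := by
  unfold ge
  have := wr_cont
  have := Real.continuous_cosh
  have := Real.continuous_sinh
  fun_prop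

lemma go_cont (m : ℕ) : Continuous (go m) := by
  unfold go
  have := wr_cont
  have := Real.continuous_cosh
  have := Real.continuous_sinh
  fun_prop

lemma exists_zero {ε₀ : ℝ} (h : 0 < ε₀) : ∃ m, 1 ≤ m ∧ ∃ ε, 0 < ε ∧ ε < ε₀ ∧ ge m ε = 0 := by
  set b := ε₀ / 2 with hb
  have hb0 : 0 < b := half_pos h
  obtain ⟨m, hm⟩ := exists_nat_gt (5 * (2 * Real.cosh b ^ 2 + 2) / (2 * (2 * b)))
  rw [div_lt_iff₀ (by positivity)] at hm
  have hm1 : 1 ≤ m := by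
    rcases Nat.eq_zero_or_pos m with h0 | h0
    · rw [h0] at hm; simp at hm; nlinarith [sq_nonneg (Real.cosh b)]
    · exact h0
  refine ⟨m, hm1, ?_⟩
  have hneg : ge m b ≤ 0 := by
    unfold ge
    have hx : 2 * m * b ≤ Real.sinh (2 * m * b) := Real.self_le_sinh_iff.2 (by positivity)
    have hD := D_pos b
    have he : Real.cosh (2 * m * b) - Real.sinh (2 * m * b) ≤ 1 := by
      rw [Real.cosh_sub_sinh]; exact Real.exp_le_one_iff.2 (by simp; positivity)
    have hp : -(-1:ℝ)^m ≤ 1 := by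
      rcases neg_one_pow_eq_or ℝ m with e | e <;> rw [e] <;> norm_num
    have h0 : 0 ≤ Real.sinh (2 * m * b) := le_trans (by positivity) hx
    nlinarith [sq_nonneg (Real.cosh b)]
  have hpos : 0 < ge m 0 := by
    unfold ge
    rcases neg_one_pow_eq_or ℝ m with e | e <;> rw [e] <;> norm_num
  obtain ⟨ε, hε, h0⟩ := intermediate_value_Icc' hb0.le (ge_cont m).continuousOn
    (Set.mem_Icc.2 ⟨hneg, hpos.le⟩)
  refine ⟨ε, lt_of_le_of_ne hε.1 ?_, by linarith [hε.2], h0⟩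
  rintro rfl
  linarith

end ModelE

namespace ModelE
open Finset Filter Topology

lemma vf_im {ε : ℝ} (h : 0 < ε) : 1 < (vf (yy ε)).im := by
  obtain ⟨h1, h2⟩ := vf_spec (yy_mem h)
  rw [tu_yy h] at h2
  have hs := Real.sinh_pos_iff.2 h
  generalize vf (yy ε) = v at *
  rw [← Complex.normSq_eq_norm_sq, Complex.normSq_apply] at h1
  unfold con at h2
  have hv0 : v ≠ 0 := by rintro rfl; norm_num at h1
  have h3 : Complex.normSq v * (v + 1 - 2 * Complex.I * (Real.sinh ε : ℂ)) + 2 * (starRingEnd ℂ) v = 0 := by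
    rw [← Complex.mul_conj]
    linear_combination (starRingEnd ℂ) v * h2
  have hre := congrArg Complex.re h3
  have him := congrArg Complex.im h3
  rw [Complex.normSq_apply] at hre him
  simp only [Complex.add_re, Complex.add_im, Complex.mul_re, Complex.mul_im, Complex.sub_re,
    Complex.sub_im, Complex.ofReal_re, Complex.ofReal_im, Complex.I_re, Complex.I_im,
    Complex.conj_re, Complex.conj_im, Complex.one_re, Complex.one_im, Complex.zero_re,
    Complex.zero_im, Complex.re_ofNat, Complex.im_ofNat] at hre him
  generalize v.re = a at *
  generalize v.im = b at *
  generalize Real.sinh ε = s at *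
  have hre' : (a*a+b*b) * (a + 1) + 2 * a = 0 := by linarith
  have him' : (a*a+b*b) * (b - 2 * s) - 2 * b = 0 := by linarith
  generalize hN : a*a+b*b = N at *
  have hb : 0 < b := by
    have : b * (N - 2) = 2 * s * N := by linarith
    have h5 : 0 < b * (N - 2) := by rw [this]; nlinarith
    exact pos_of_mul_pos_left h5 (by linarith)
  have ha : a < 0 := by
    by_contra hh; push Not at hh; nlinarith
  have ha1 : -1 < a := by
    by_contra hh; push Not at hh; nlinarith
  nlinarith

lemma qf_yy {ε : ℝ} (h : 0 < ε) : qf (yy ε) = -Complex.I * (Real.exp (-ε) : ℂ) := by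
  obtain ⟨h0, h1, h2⟩ := qf_spec (yy_mem h)
  rw [tu_yy h] at h2
  generalize qf (yy ε) = q at *
  have h3 : q^2 - 2 * Complex.I * (Real.sinh ε : ℂ) * q + 1 = 0 := by
    field_simp at h2; linear_combination -h2
  have e1 : (Real.sinh ε : ℂ) = ((Real.exp ε : ℂ) - (Real.exp (-ε) : ℂ)) / 2 := by
    rw [Real.sinh_eq]; push_cast; ring
  have e2 : (Real.exp ε : ℂ) * (Real.exp (-ε) : ℂ) = 1 := by
    rw [← Complex.ofReal_mul, ← Real.exp_add]; simp
  have h4 : (q + Complex.I * (Real.exp (-ε) : ℂ)) * (q - Complex.I * (Real.exp ε : ℂ)) = 0 := by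
    rw [e1] at h3
    linear_combination h3 + e2 - ((Real.exp ε : ℂ) * (Real.exp (-ε) : ℂ)) * Complex.I_sq
  rcases mul_eq_zero.1 h4 with h5 | h5
  · linear_combination h5
  · exfalso
    have : q = Complex.I * (Real.exp ε : ℂ) := by linear_combination h5
    rw [this, norm_mul, Complex.norm_I, one_mul, Complex.norm_real, Real.norm_eq_abs,
      abs_of_pos (Real.exp_pos _)] at h1
    have := Real.add_one_le_exp ε
    linarith

lemma small_eps {ε : ℝ} (h : 0 < ε) (h1 : ε ≤ 1/10) :
    9/10 ≤ Real.exp (-ε) ∧ Real.sinh ε ≤ 2/5 := by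
  have a := Real.add_one_le_exp (-ε)
  have b : Real.exp ε * Real.exp (-ε) = 1 := by rw [← Real.exp_add]; simp
  refine ⟨by linarith, ?_⟩
  rw [Real.sinh_eq]
  have : Real.exp ε ≤ 10/9 := by
    have := Real.exp_pos ε
    nlinarith
  linarith

lemma vn_ne {ε : ℝ} (h : 0 < ε) (h1 : ε ≤ 1/10) (n : ℕ) : sq (tu (yy ε)) (vf (yy ε)) 1 n ≠ 0 := by
  obtain ⟨he, hs⟩ := small_eps h h1
  have hs0 := Real.sinh_pos_iff.2 h
  have hy := yy_mem h
  obtain ⟨q0, q1, hq⟩ := qf_spec hy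
  have hC := Real.one_le_cosh ε
  have hC2 := Real.cosh_sq ε
  have hdisc := disc_eq q0 hq
  have h4 : tu (yy ε)^2 - 4 = -((4 * Real.cosh ε ^ 2 : ℝ) : ℂ) := by
    rw [tu_yy h]
    have : (Real.cosh ε : ℂ)^2 = (Real.sinh ε : ℂ)^2 + 1 := by exact_mod_cast hC2
    rw [Complex.ofReal_mul, Complex.ofReal_pow, this]
    push_cast
    linear_combination (4 * Complex.sinh ε ^2) * Complex.I_sq
  have hdn : ‖(qf (yy ε))⁻¹ - qf (yy ε)‖ = 2 * Real.cosh ε := by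
    have := congrArg norm hdisc
    rw [h4, norm_neg, Complex.norm_real, norm_pow, Real.norm_eq_abs, abs_of_nonneg (by positivity)] at this
    have e : ‖(qf (yy ε))⁻¹ - qf (yy ε)‖^2 = (2 * Real.cosh ε)^2 := by rw [← this]; ring
    exact (pow_left_inj₀ (norm_nonneg _) (by positivity) two_ne_zero).1 e
  have hd0 : (qf (yy ε))⁻¹ - qf (yy ε) ≠ 0 := by
    rw [← norm_pos_iff, hdn]; positivity
  have hba := bt_mul_at (u1 := vf (yy ε)) (p := 1) q0 hd0 hq (by simpa using (vf_spec hy).2)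
  have hban : ‖bt (tu (yy ε)) (vf (yy ε)) (qf (yy ε)) 1‖ * ‖atCoef (tu (yy ε)) (vf (yy ε)) (qf (yy ε)) 1‖ ≤ 1 := by
    have e : -((tu (yy ε))^2 - 3) = ((4 * Real.cosh ε ^ 2 - 1 : ℝ) : ℂ) := by
      push_cast at h4 ⊢
      linear_combination -h4
    rw [e, h4] at hba
    have := congrArg norm hba
    rw [norm_mul, norm_mul, norm_neg, Complex.norm_real, Complex.norm_real, Real.norm_eq_abs,
      Real.norm_eq_abs, abs_of_nonneg (by positivity), abs_of_nonneg (by nlinarith)] at this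
    have hp : 0 < 4 * Real.cosh ε ^2 := by positivity
    by_contra hh
    push Not at hh
    nlinarith
  have hcn : ∀ n, ‖cn (tu (yy ε)) 1 n‖ ≤ 1 / (2 * Real.cosh ε ^ 2) := by
    intro n
    have ht : ‖tu (yy ε)‖ ≤ 2 := by
      rw [tu_yy h, norm_mul, norm_mul, Complex.norm_I, Complex.norm_real, Real.norm_eq_abs,
        abs_of_pos hs0]
      simp; linarith
    have e : (1:ℝ) / (2 * Real.cosh ε ^ 2) = 2 / (4 * Real.cosh ε ^2) := by field_simp; norm_num
    unfold cn
    rw [h4, e]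
    split_ifs
    · rw [norm_div, norm_neg, Complex.norm_real, Real.norm_eq_abs, abs_of_nonneg (by positivity)]
      simp
    · rw [norm_div, norm_neg, Complex.norm_real, Real.norm_eq_abs, abs_of_nonneg (by positivity)]
      gcongr
  have hbt : 17/10 ≤ ‖bt (tu (yy ε)) (vf (yy ε)) (qf (yy ε)) 1‖ := by
    have hv := vf_im h
    have hr : (Real.cosh ε : ℂ) ≠ 0 := by exact_mod_cast (by positivity : Real.cosh ε ≠ 0)
    have e : bt (tu (yy ε)) (vf (yy ε)) (qf (yy ε)) 1 = vf (yy ε)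
        + ((1 / (2 * Real.cosh ε ^2) : ℝ) : ℂ) + Complex.I * (Real.exp (-ε) : ℂ)
        - ((Real.exp (-ε) * Real.sinh ε / (2 * Real.cosh ε ^2) : ℝ) : ℂ) := by
      unfold bt cn
      rw [if_pos (by norm_num), if_neg (by norm_num), h4, qf_yy h, tu_yy h]
      push_cast at hr ⊢
      field_simp
      linear_combination (4 * (Complex.exp (-ε)) * Complex.sinh ε) * Complex.I_sq
    have i := congrArg Complex.im e
    simp only [Complex.add_im, Complex.sub_im, Complex.ofReal_im, Complex.I_mul_im, Complex.ofReal_re] at i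
    have := Complex.abs_im_le_norm (bt (tu (yy ε)) (vf (yy ε)) (qf (yy ε)) 1)
    have := le_abs_self (bt (tu (yy ε)) (vf (yy ε)) (qf (yy ε)) 1).im
    linarith
  have hcl := sq_closed (u1 := vf (yy ε)) (p := 1) q0 hd0 hq n
  intro hz
  rw [hz, zero_sub] at hcl
  have hcn' := hcn n
  generalize bt (tu (yy ε)) (vf (yy ε)) (qf (yy ε)) 1 = B at *
  generalize atCoef (tu (yy ε)) (vf (yy ε)) (qf (yy ε)) 1 = A at *
  generalize cn (tu (yy ε)) 1 n = c at *
  have e : B * (qf (yy ε))⁻¹^n = A * (qf (yy ε))^n - ((qf (yy ε))⁻¹ - qf (yy ε)) * c := by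
    linear_combination -hcl
  have n1 := congrArg norm e
  have n2 := norm_sub_le (A * (qf (yy ε))^n) (((qf (yy ε))⁻¹ - qf (yy ε)) * c)
  rw [← n1] at n2
  rw [norm_mul, norm_mul, norm_mul, hdn, norm_pow, norm_pow, norm_inv] at n2
  have p1 : 1 ≤ ‖qf (yy ε)‖⁻¹^n := one_le_pow₀ ((one_le_inv₀ (norm_pos_iff.2 q0)).2 q1.le)
  have p2 : ‖qf (yy ε)‖^n ≤ 1 := pow_le_one₀ (norm_nonneg _) q1.le
  have p3 : 2 * Real.cosh ε * ‖c‖ ≤ 1 := by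
    calc 2 * Real.cosh ε * ‖c‖ ≤ 2 * Real.cosh ε * (1 / (2 * Real.cosh ε ^2)) := by gcongr
      _ = 1 / Real.cosh ε := by field_simp
      _ ≤ 1 := by rw [div_le_one (by positivity)]; exact hC
  have p4 : ‖A‖ * ‖qf (yy ε)‖^n ≤ ‖A‖ := mul_le_of_le_one_right (norm_nonneg _) p2
  have p5 : ‖B‖ ≤ ‖B‖ * ‖qf (yy ε)‖⁻¹^n := le_mul_of_one_le_right (norm_nonneg _) p1
  nlinarith [norm_nonneg A]

end ModelE

namespace ModelE
open Finset Filter Topology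

/-- real terms of the alternating sum -/
noncomputable def Rt (n : ℕ) (ε : ℝ) : ℝ :=
  if n % 2 = 0 then 4 * Real.cosh ε ^ 4 / (ge (n/2) ε * go (n/2) ε)
  else 4 * Real.cosh ε ^ 4 / (ge (n/2+1) ε * go (n/2) ε)

lemma term_eq {ε : ℝ} (h : 0 < ε) (n : ℕ) :
    (-1)^n / (sq (tu (yy ε)) (3 / yy ε) 0 n * sq (tu (yy ε)) (3 / yy ε) 0 (n+1))
      = -Complex.I * (Rt n ε : ℂ) := by
  have hC : (Real.cosh ε : ℂ) ≠ 0 := by exact_mod_cast (Real.cosh_pos ε).ne'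
  have hI := Complex.I_ne_zero
  have hp : ∀ m : ℕ, ((-1:ℂ)^m)^2 = 1 := fun m => by rw [← pow_mul, mul_comm, pow_mul]; simp
  have key : ∀ X Y G O K s : ℂ, X * Y * 4 * K^4 = s * Complex.I * (G * O) → K ≠ 0 → s^2 = 1 →
      s / (X * Y) = -Complex.I * (4 * K^4 / (G * O)) := by
    intro X Y G O K s e hK hs
    have hs0 : s ≠ 0 := by rintro rfl; norm_num at hs
    have e' : X * Y = s * Complex.I * (G * O) / (4 * K^4) := by
      rw [eq_div_iff (mul_ne_zero (by norm_num) (pow_ne_zero _ hK))]; linear_combination e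
    rw [e']
    by_cases hGO : G * O = 0
    · rw [hGO]; simp
    · generalize G * O = D at *
      field_simp
      linear_combination Complex.I_sq
  rcases Nat.even_or_odd' n with ⟨m, rfl | rfl⟩
  · have h1 : (2 * m) % 2 = 0 := by omega
    have h2 : 2 * m / 2 = m := by omega
    unfold Rt
    rw [if_pos h1, h2]
    obtain ⟨a, b⟩ := sq_yy h m
    push_cast at a b hC ⊢
    refine key _ _ _ _ _ _ ?_ hC (hp _)
    rw [pow_mul]; norm_num
    linear_combination (2 * Complex.cosh ε ^2 * sq (tu (yy ε)) (3 / yy ε) 0 (2 * m + 1)) * a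
      + ((-1)^m * (ge m ε : ℂ)) * b + (Complex.I * ge m ε * go m ε) * hp m
  · have h1 : ¬ (2 * m + 1) % 2 = 0 := by omega
    have h2 : (2 * m + 1) / 2 = m := by omega
    unfold Rt
    rw [if_neg h1, h2]
    obtain ⟨_, b⟩ := sq_yy h m
    obtain ⟨a, _⟩ := sq_yy h (m+1)
    push_cast at a b hC ⊢
    rw [show 2 * m + 1 + 1 = 2 * (m+1) by ring]
    refine key _ _ _ _ _ _ ?_ hC (hp _)
    rw [pow_succ (-1:ℂ) (2 * m), pow_mul]; norm_num
    rw [pow_succ] at a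
    linear_combination (2 * Complex.cosh ε ^2 * sq (tu (yy ε)) (3 / yy ε) 0 (2 * m + 1)) * a
      - ((-1)^m * (ge (m+1) ε : ℂ)) * b - (Complex.I * ge (m+1) ε * go m ε) * hp m

lemma lim_zero {ε : ℝ} (h : 0 < ε) (h1 : ε < 1/10) (m k : ℕ) (hz : ge m ε = 0) :
    Tendsto (fun x => 4 * Real.cosh x ^ 4 / (ge m x * go k x)) (𝓝[>] ε) atTop := by
  have hm : 1 ≤ m := by
    rcases Nat.eq_zero_or_pos m with h0 | h0
    · rw [h0] at hz; unfold ge at hz; simp at hz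
      exact absurd hz (Real.cosh_pos ε).ne'
    · exact h0
  have t1 : Tendsto (fun x => ge m x * go k x) (𝓝[>] ε) (𝓝[>] 0) := by
    refine tendsto_nhdsWithin_iff.2 ⟨?_, ?_⟩
    · have : Tendsto (fun x => ge m x * go k x) (𝓝 ε) (𝓝 (ge m ε * go k ε)) :=
        ((ge_cont m).mul (go_cont k)).tendsto ε
      rw [hz, zero_mul] at this
      exact this.mono_left nhdsWithin_le_nhds
    · filter_upwards [self_mem_nhdsWithin, mem_nhdsWithin_of_mem_nhds (Iio_mem_nhds h1)] with x hx hx1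
      have hx' : ε < x := hx
      have hx2 : x < 1/10 := hx1
      have a := ge_anti hm h.le hx'
      rw [hz] at a
      have b := go_neg (h.trans hx') (small_eps (h.trans hx') hx2.le).2 k
      exact mul_pos_of_neg_of_neg a b
  have t2 := tendsto_inv_nhdsGT_zero.comp t1
  have t3 : Tendsto (fun x => 4 * Real.cosh x ^ 4) (𝓝[>] ε) (𝓝 (4 * Real.cosh ε ^ 4)) := by
    have : Continuous (fun x => 4 * Real.cosh x ^ 4) := by
      have := Real.continuous_cosh
      fun_prop
    exact (this.tendsto ε).mono_left nhdsWithin_le_nhds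
  have hpos : 0 < 4 * Real.cosh ε ^ 4 := by positivity
  exact t3.pos_mul_atTop hpos t2

lemma lim_nz {ε : ℝ} (h : 0 < ε) (h1 : ε < 1/10) (m k : ℕ) (hz : ge m ε ≠ 0) :
    ∃ c, Tendsto (fun x => 4 * Real.cosh x ^ 4 / (ge m x * go k x)) (𝓝[>] ε) (𝓝 c) := by
  have b := go_neg h (small_eps h h1.le).2 k
  have : ContinuousAt (fun x => 4 * Real.cosh x ^ 4 / (ge m x * go k x)) ε := by
    refine ContinuousAt.div ?_ ((ge_cont m).mul (go_cont k)).continuousAt (mul_ne_zero hz b.ne)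
    have := Real.continuous_cosh
    fun_prop
  exact ⟨_, this.tendsto.mono_left nhdsWithin_le_nhds⟩

lemma lim_any {ε : ℝ} (h : 0 < ε) (h1 : ε < 1/10) (m k : ℕ) :
    ∃ c, ∀ᶠ x in 𝓝[>] ε, c ≤ 4 * Real.cosh x ^ 4 / (ge m x * go k x) := by
  by_cases hz : ge m ε = 0
  · exact ⟨0, (lim_zero h h1 m k hz).eventually_ge_atTop 0⟩
  · obtain ⟨c, hc⟩ := lim_nz h h1 m k hz
    exact ⟨c - 1, hc.eventually_const_le (by linarith)⟩

lemma Rt_any {ε : ℝ} (h : 0 < ε) (h1 : ε < 1/10) (n : ℕ) :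
    ∃ c, ∀ᶠ x in 𝓝[>] ε, c ≤ Rt n x := by
  unfold Rt
  split_ifs
  · exact lim_any h h1 _ _
  · exact lim_any h h1 _ _

lemma sum_lim {ε : ℝ} (h : 0 < ε) (h1 : ε < 1/10) {m N : ℕ} (hz : ge m ε = 0) (hN : 2 * m < N) :
    Tendsto (fun x => ∑ n ∈ range N, Rt n x) (𝓝[>] ε) atTop := by
  choose c hc using Rt_any h h1
  have hmem : 2 * m ∈ range N := mem_range.2 hN
  have e : ∀ x, ∑ n ∈ range N, Rt n x = Rt (2 * m) x + ∑ n ∈ (range N).erase (2 * m), Rt n x :=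
    fun x => (add_sum_erase _ _ hmem).symm
  simp only [e]
  refine tendsto_atTop_add_right_of_le' _ (∑ n ∈ (range N).erase (2 * m), c n) ?_ ?_
  · have := lim_zero h h1 m m hz
    refine this.congr fun x => ?_
    unfold Rt
    rw [if_pos (by omega), show 2 * m / 2 = m by omega]
  · have : ∀ᶠ x in 𝓝[>] ε, ∀ n ∈ (range N).erase (2 * m), c n ≤ Rt n x :=
      (Filter.eventually_all_finset _).2 fun n _ => hc n
    filter_upwards [this] with x hx
    exact sum_le_sum hx

lemma yy_cont : Continuous yy := by
  unfold yy
  have := wr_cont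
  have := Real.continuous_sinh
  fun_prop

lemma Af_nolim {ε : ℝ} (h : 0 < ε) (h1 : ε < 1/10) {m : ℕ} (hz : ge m ε = 0) (c : ℂ) :
    ¬ Tendsto Af (𝓝[≠] (yy ε)) (𝓝 c) := by
  intro hA
  obtain ⟨N, T, hT, hev⟩ := Af_local (yy_mem h)
  have hyt : Tendsto yy (𝓝[>] ε) (𝓝 (yy ε)) := (yy_cont.tendsto ε).mono_left nhdsWithin_le_nhds
  have hyt' : Tendsto yy (𝓝[>] ε) (𝓝[≠] (yy ε)) := by
    refine tendsto_nhdsWithin_iff.2 ⟨hyt, ?_⟩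
    filter_upwards [self_mem_nhdsWithin] with x hx
    have hx' : ε < x := hx
    intro he
    have he' : yy x = yy ε := he
    have h2 := congrArg tu he'
    rw [tu_yy h, tu_yy (h.trans hx')] at h2
    have h3 := mul_left_cancel₀ (mul_ne_zero two_ne_zero Complex.I_ne_zero) h2
    have h4 : Real.sinh x = Real.sinh ε := by exact_mod_cast h3
    exact hx'.ne' (Real.sinh_injective h4)
  have hN : 2 * m < N := by
    by_contra hh
    push Not at hh
    apply (hev.self_of_nhds).1 (2 * m) hh
    have := (sq_yy h m).1
    rw [hz, Complex.ofReal_zero, mul_zero] at this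
    have hC : (Real.cosh ε : ℂ) ≠ 0 := by exact_mod_cast (Real.cosh_pos ε).ne'
    exact (mul_eq_zero.1 this).resolve_left (mul_ne_zero two_ne_zero (pow_ne_zero _ hC))
  have hs := sum_lim h h1 hz hN
  have l1 : Tendsto (fun x => (Complex.I * (Af (yy x) - T (yy x))).re) (𝓝[>] ε)
      (𝓝 (Complex.I * (c - T (yy ε))).re) := by
    refine (Complex.continuous_re.tendsto _).comp ?_
    exact tendsto_const_nhds.mul ((hA.comp hyt').sub (hT.continuousAt.tendsto.comp hyt))
  have l2 : (fun x => (Complex.I * (Af (yy x) - T (yy x))).re) =ᶠ[𝓝[>] ε]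
      (fun x => ∑ n ∈ range N, Rt n x) := by
    filter_upwards [self_mem_nhdsWithin, hyt.eventually hev] with x hx hx2
    have hx' : 0 < x := h.trans hx
    rw [hx2.2, sum_congr rfl fun n _ => term_eq hx' n, ← mul_sum, ← Complex.ofReal_sum]
    generalize (∑ n ∈ range N, Rt n x) = S
    have : Complex.I * (-Complex.I * (S : ℂ) + T (yy x) - T (yy x)) = S := by
      linear_combination -(S:ℂ) * Complex.I_sq
    rw [this, Complex.ofReal_re]
  exact not_tendsto_nhds_of_tendsto_atTop hs _ (l1.congr' l2)

theorem poles {ε₀ : ℝ} (h : 0 < ε₀) : ∃ ε, 0 < ε ∧ ε < ε₀ ∧ AnalyticAt ℂ Bf (yy ε) ∧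
    ∀ c, ¬ Tendsto Af (𝓝[≠] (yy ε)) (𝓝 c) := by
  obtain ⟨m, hm, ε, h0, h1, hz⟩ := exists_zero (lt_min h (by norm_num : (0:ℝ) < 1/10))
  have h2 := h1.trans_le (min_le_right _ _)
  exact ⟨ε, h0, h1.trans_le (min_le_left _ _), Bf_analytic (yy_mem h0) (vn_ne h0 h2.le),
    Af_nolim h0 h2 hz⟩

end ModelE

namespace ModelE
open Finset Filter Topology

/-- summability inside the disc of radius 1/4 -/
def Cond (G : PowerSeries ℚ) : Prop :=
  ∀ z : ℂ, ‖z‖ < 1/4 → Summable fun n => ‖((PowerSeries.coeff n G : ℚ) : ℂ) * z^n‖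

/-- evaluation -/
noncomputable def ev (G : PowerSeries ℚ) (z : ℂ) : ℂ := ∑' n, ((PowerSeries.coeff n G : ℚ) : ℂ) * z^n

lemma ev_deriv_aux {G : PowerSeries ℚ} (hG : Cond G) {z : ℂ} (hz : ‖z‖ < 1/4) :
    HasSum (fun n => ((PowerSeries.coeff n (PowerSeries.derivativeFun G) : ℚ) : ℂ) * z^n)
      (deriv (ev G) z) ∧ DifferentiableAt ℂ (ev G) z := by
  obtain ⟨ρ, h1, h2⟩ := exists_between hz
  have hρ : 0 < ρ := (norm_nonneg _).trans_lt h1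
  have hu := hG (ρ : ℂ) (by rw [Complex.norm_real, Real.norm_eq_abs, abs_of_pos hρ]; exact h2)
  have hd : ∀ n : ℕ, DifferentiableOn ℂ (fun w : ℂ => ((PowerSeries.coeff n G : ℚ) : ℂ) * w^n)
      (Metric.ball 0 ρ) := fun n => by fun_prop
  have hb : ∀ n : ℕ, ∀ w ∈ Metric.ball (0:ℂ) ρ, ‖((PowerSeries.coeff n G : ℚ) : ℂ) * w^n‖ ≤
      ‖((PowerSeries.coeff n G : ℚ) : ℂ) * (ρ:ℂ)^n‖ := by
    intro n w hw
    rw [mem_ball_zero_iff] at hw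
    rw [norm_mul, norm_mul, norm_pow, norm_pow, Complex.norm_real, Real.norm_eq_abs, abs_of_pos hρ]
    gcongr
  have hzm : z ∈ Metric.ball (0:ℂ) ρ := by rwa [mem_ball_zero_iff]
  constructor
  · have hs := Complex.hasSum_deriv_of_summable_norm hu hd Metric.isOpen_ball hb hzm
    rw [← hasSum_nat_add_iff' 1] at hs
    simp only [range_one, sum_singleton, pow_zero, mul_one, deriv_const, sub_zero] at hs
    have he : (fun n => ((PowerSeries.coeff n (PowerSeries.derivativeFun G) : ℚ) : ℂ) * z^n) =
        fun n => deriv (fun w : ℂ => ((PowerSeries.coeff (n+1) G : ℚ) : ℂ) * w^(n+1)) z := by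
      funext n
      have hc : PowerSeries.coeff n (PowerSeries.derivativeFun G) =
        PowerSeries.coeff (n + 1) G * (n + 1) := PowerSeries.coeff_derivative ..
      rw [hc, deriv_const_mul_field, deriv_pow_field]
      push_cast [Nat.add_sub_cancel]; ring
    rw [he]
    exact hs
  · exact (Complex.differentiableOn_tsum_of_summable_norm hu hd Metric.isOpen_ball hb).differentiableAt
      (Metric.isOpen_ball.mem_nhds hzm)

lemma Cond_deriv {G : PowerSeries ℚ} (hG : Cond G) : Cond (PowerSeries.derivativeFun G) :=
  fun _ hz => (ev_deriv_aux hG hz).1.summable.norm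

lemma ev_deriv {G : PowerSeries ℚ} (hG : Cond G) {z : ℂ} (hz : ‖z‖ < 1/4) :
    HasDerivAt (ev G) (ev (PowerSeries.derivativeFun G) z) z := by
  obtain ⟨h1, h2⟩ := ev_deriv_aux hG hz
  have := h2.hasDerivAt
  rwa [← h1.tsum_eq] at this

lemma coeff_poly_eq (p : Polynomial ℚ) (z : ℂ) : ∀ n ∉ range (p.natDegree + 1),
    ((PowerSeries.coeff n (p : PowerSeries ℚ) : ℚ) : ℂ) * z^n = 0 := by
  intro n hn
  rw [Polynomial.coeff_coe, Polynomial.coeff_eq_zero_of_natDegree_lt (by simpa using hn)]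
  simp

lemma Cond_poly (p : Polynomial ℚ) : Cond (p : PowerSeries ℚ) := fun z _ =>
  (summable_of_ne_finset_zero (coeff_poly_eq p z)).norm

lemma ev_poly (p : Polynomial ℚ) (z : ℂ) : ev (p : PowerSeries ℚ) z = Polynomial.aeval z p := by
  unfold ev
  rw [tsum_eq_sum (coeff_poly_eq p z), Polynomial.aeval_eq_sum_range]
  refine sum_congr rfl fun n _ => ?_
  rw [Polynomial.coeff_coe, Rat.smul_def]

lemma coeff_mul_eq (G H : PowerSeries ℚ) (z : ℂ) (n : ℕ) :
    ((PowerSeries.coeff n (G * H) : ℚ) : ℂ) * z^n = ∑ kl ∈ antidiagonal n,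
      (((PowerSeries.coeff kl.1 G : ℚ) : ℂ) * z^kl.1) * (((PowerSeries.coeff kl.2 H : ℚ) : ℂ) * z^kl.2) := by
  rw [PowerSeries.coeff_mul]
  push_cast
  rw [sum_mul]
  refine sum_congr rfl fun kl h => ?_
  rw [← mem_antidiagonal.1 h, pow_add]; ring

lemma Cond_mul {G H : PowerSeries ℚ} (hG : Cond G) (hH : Cond H) : Cond (G * H) := by
  intro z hz
  have h1 := summable_norm_sum_mul_antidiagonal_of_summable_norm (hG z hz) (hH z hz)
  refine h1.congr fun n => ?_
  rw [coeff_mul_eq]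

lemma ev_mul {G H : PowerSeries ℚ} (hG : Cond G) (hH : Cond H) {z : ℂ} (hz : ‖z‖ < 1/4) :
    ev (G * H) z = ev G z * ev H z := by
  unfold ev
  simp only [coeff_mul_eq]
  exact (tsum_mul_tsum_eq_tsum_sum_antidiagonal_of_summable_norm (hG z hz) (hH z hz)).symm

lemma ev_sum {ι : Type*} (s : Finset ι) (G : ι → PowerSeries ℚ) (hG : ∀ i ∈ s, Cond (G i)) {z : ℂ}
    (hz : ‖z‖ < 1/4) : ev (∑ i ∈ s, G i) z = ∑ i ∈ s, ev (G i) z := by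
  unfold ev
  rw [← Summable.tsum_finsetSum fun i hi => (hG i hi z hz).of_norm]
  refine tsum_congr fun n => ?_
  rw [map_sum]; push_cast; rw [sum_mul]

lemma Cond_walk : Cond (walkGF SE) := by
  intro z hz
  refine Summable.of_nonneg_of_le (fun _ => norm_nonneg _) (f := fun n => (4 * ‖z‖)^n) ?_
    (summable_geometric_of_lt_one (by positivity) (by linarith))
  intro n
  have h1 : ((PowerSeries.coeff n (walkGF SE) : ℚ) : ℂ) = Qn n 1 1 := by
    rw [Qn_one]; simp [walkGF]
  rw [h1, norm_mul, norm_pow, mul_pow]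
  gcongr
  exact Qn_norm_le n 1 1 (by simp) (by simp)

lemma ev_walk (z : ℂ) : ev (walkGF SE) z = ∑' n, (quarterPlaneWalks SE n : ℂ) * z^n := by
  unfold ev walkGF
  simp

lemma Cond_iter (i : ℕ) : Cond (PowerSeries.derivativeFun^[i] (walkGF SE)) := by
  induction i with
  | zero => exact Cond_walk
  | succ i ih => rw [Function.iterate_succ_apply']; exact Cond_deriv ih

lemma ode_eval {r : ℕ} {p : ℕ → Polynomial ℚ} (h : ∑ i ∈ range (r + 1),
    (p i : PowerSeries ℚ) * (PowerSeries.derivativeFun^[i] (walkGF SE)) = 0) {z : ℂ} (hz : ‖z‖ < 1/4) :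
    ∑ i ∈ range (r+1), Polynomial.aeval z (p i) * ev (PowerSeries.derivativeFun^[i] (walkGF SE)) z = 0 := by
  have h1 := ev_sum (range (r+1)) (fun i => (p i : PowerSeries ℚ) *
    (PowerSeries.derivativeFun^[i] (walkGF SE))) (fun i _ => Cond_mul (Cond_poly _) (Cond_iter _)) hz
  rw [h] at h1
  have h0 : ev 0 z = 0 := by simp [ev]
  rw [h0] at h1
  rw [h1]
  refine sum_congr rfl fun i _ => ?_
  rw [ev_mul (Cond_poly _) (Cond_iter _) hz, ev_poly]

end ModelE

namespace ModelE
open Finset Filter Topology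

/-- parameter -/
noncomputable def tt (y : ℂ) : ℂ := (tu y)⁻¹
/-- its derivative -/
noncomputable def th (y : ℂ) : ℂ := -(1 - 3 / y^2) / (tu y)^2
/-- continued generating function -/
noncomputable def ff (y : ℂ) : ℂ := (1 - Af y - Bf y) / (1 - 4 * tt y)
/-- transported derivation -/
noncomputable def Dop (f : ℂ → ℂ) : ℂ → ℂ := (fun y => (th y)⁻¹) * deriv f

lemma tu_ne {y : ℂ} (hy : y ∈ Om) : tu y ≠ 0 := by
  simpa using Om_ne_real hy (c := 0) (by norm_num)

lemma tt_deriv {y : ℂ} (hy : y ∈ Om) : HasDerivAt tt (th y) y := by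
  have h0 := Om_ne hy
  have h1 : HasDerivAt tu (1 - 3 / y^2) y := by
    have := (hasDerivAt_id y).add ((hasDerivAt_inv h0).const_mul 3)
    refine (this.congr_deriv ?_).congr_of_eventuallyEq ?_
    · field_simp; ring
    · exact Eventually.of_forall fun z => by simp [tu, div_eq_mul_inv]
  exact h1.inv (tu_ne hy)

lemma th_ne {y : ℂ} (hy : y ∈ Om) : th y ≠ 0 := by
  unfold th
  refine div_ne_zero (neg_ne_zero.2 ?_) (pow_ne_zero _ (tu_ne hy))
  intro h
  have h0 := Om_ne hy
  have h2 : y^2 = 3 := by field_simp at h; linear_combination h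
  have him := congrArg Complex.im h2
  have hre := congrArg Complex.re h2
  rw [pow_two] at him hre
  simp at him hre
  have hi := Om_im hy
  have : y.re = 0 := by
    have : y.re * y.im = 0 := by linarith
    exact (mul_eq_zero.1 this).resolve_right hi.ne'
  rw [this] at hre
  nlinarith

lemma th_analytic {y : ℂ} (hy : y ∈ Om) : AnalyticAt ℂ th y := by
  unfold th
  have h1 := tu_analyticAt (Om_ne hy)
  have h2 : AnalyticAt ℂ (fun y : ℂ => 3 / y^2) y :=
    analyticAt_const.fun_div (analyticAt_id.fun_pow 2) (pow_ne_zero _ (Om_ne hy))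
  exact ((analyticAt_const.fun_sub h2).fun_neg).fun_div (h1.fun_pow 2) (pow_ne_zero _ (tu_ne hy))

lemma thi_analytic {y : ℂ} (hy : y ∈ Om) : AnalyticAt ℂ (fun y => (th y)⁻¹) y :=
  (th_analytic hy).fun_inv (th_ne hy)

lemma tt_analytic {y : ℂ} (hy : y ∈ Om) : AnalyticAt ℂ tt y :=
  (tu_analyticAt (Om_ne hy)).fun_inv (tu_ne hy)

lemma den_ne {y : ℂ} (hy : y ∈ Om) : 1 - 4 * tt y ≠ 0 := by
  unfold tt
  intro h
  have h1 := tu_ne hy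
  have h2 : tu y ≠ 4 := by simpa using Om_ne_real hy (c := 4) (by norm_num)
  field_simp at h
  exact h2 (by linear_combination h)

lemma ff_mero {y : ℂ} (hy : y ∈ Om) : MeromorphicAt ff y :=
  ((analyticAt_const.meromorphicAt.fun_sub (Af_mero hy)).fun_sub (Bf_mero hy)).fun_div
    (analyticAt_const.fun_sub (analyticAt_const.fun_mul (tt_analytic hy))).meromorphicAt

lemma Dop_mero {f : ℂ → ℂ} {y : ℂ} (hy : y ∈ Om) (hf : MeromorphicAt f y) : MeromorphicAt (Dop f) y :=
  (thi_analytic hy).meromorphicAt.mul hf.deriv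

lemma Dop_iter_mero {y : ℂ} (hy : y ∈ Om) (i : ℕ) : MeromorphicAt (Dop^[i] ff) y := by
  induction i with
  | zero => exact ff_mero hy
  | succ i ih => rw [Function.iterate_succ_apply']; exact Dop_mero hy ih

/-- small half disc -/
def VV : Set ℂ := {y | 0 < y.im ∧ ‖y‖ < 1/10}

lemma VV_open : IsOpen VV := (isOpen_lt continuous_const Complex.continuous_im).inter
      (isOpen_lt continuous_norm continuous_const)

lemma VV_sub {y : ℂ} (hy : y ∈ VV) : y ∈ Om := Or.inl (Or.inl ⟨hy.1, by linarith [hy.2, s3]⟩)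

lemma ff_VV (i : ℕ) : ∀ y ∈ VV, (Dop^[i] ff) y = ev (PowerSeries.derivativeFun^[i] (walkGF SE)) (tt y) := by
  induction i with
  | zero =>
    intro y hy
    obtain ⟨h1, h2⟩ := small_formula hy.1 hy.2
    have hd := den_ne (VV_sub hy)
    show ff y = ev (walkGF SE) (tt y)
    unfold ff
    rw [div_eq_iff hd, ev_walk]
    unfold tt
    rw [← h2]; ring
  | succ i ih =>
    intro y hy
    rw [Function.iterate_succ_apply', Function.iterate_succ_apply']
    have hO := VV_sub hy
    have ht : ‖tt y‖ < 1/4 := lt_of_le_of_lt (small_formula hy.1 hy.2).1 (by norm_num)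
    have h1 : HasDerivAt (Dop^[i] ff)
        (ev (PowerSeries.derivativeFun (PowerSeries.derivativeFun^[i] (walkGF SE))) (tt y) * th y) y := by
      refine ((ev_deriv (Cond_iter i) ht).comp y (tt_deriv hO)).congr_of_eventuallyEq ?_
      filter_upwards [VV_open.mem_nhds hy] with z hz using ih z hz
    show (th y)⁻¹ * deriv (Dop^[i] ff) y = _
    rw [h1.deriv]
    have := th_ne hO
    field_simp

lemma poly_analytic {y : ℂ} (hy : y ∈ Om) (p : Polynomial ℚ) :
    AnalyticAt ℂ (fun y => Polynomial.aeval (tt y) p) y := by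
  have h := tt_analytic hy
  simp only [Polynomial.aeval_eq_sum_range]
  refine Finset.analyticAt_fun_sum _ fun n _ => ?_
  simp only [Rat.smul_def]
  exact analyticAt_const.fun_mul (h.fun_pow n)

lemma phi_zero {r : ℕ} {p : ℕ → Polynomial ℚ} (h : ∑ i ∈ range (r + 1),
    (p i : PowerSeries ℚ) * (PowerSeries.derivativeFun^[i] (walkGF SE)) = 0) {y : ℂ} (hy : y ∈ Om) :
    meromorphicOrderAt (∑ i ∈ range (r+1), (fun y => Polynomial.aeval (tt y) (p i)) * (Dop^[i] ff)) y = ⊤ := by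
  set Φ := ∑ i ∈ range (r+1), (fun y => Polynomial.aeval (tt y) (p i)) * (Dop^[i] ff) with hΦ
  have hm : MeromorphicOn Φ Om := fun z hz => by
    rw [hΦ]
    exact MeromorphicAt.sum fun i _ => (poly_analytic hz (p i)).meromorphicAt.mul (Dop_iter_mero hz i)
  have hz0 : (⟨0, 1/20⟩ : ℂ) ∈ VV := by
    refine ⟨by norm_num, ?_⟩
    rw [Complex.norm_eq_sqrt_sq_add_sq, Real.sqrt_lt' (by norm_num)]; norm_num
  by_contra hne
  apply hm.meromorphicOrderAt_ne_top_of_isPreconnected Om_conn hy (VV_sub hz0) hne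
  rw [meromorphicOrderAt_eq_top_iff]
  refine Filter.Eventually.filter_mono nhdsWithin_le_nhds ?_
  filter_upwards [VV_open.mem_nhds hz0] with z hz
  have ht : ‖tt z‖ < 1/4 := lt_of_le_of_lt (small_formula hz.1 hz.2).1 (by norm_num)
  rw [hΦ, Finset.sum_apply, ← ode_eval h ht]
  refine sum_congr rfl fun i _ => ?_
  rw [Pi.mul_apply, ff_VV i z hz]

lemma ff_order {y : ℂ} (hy : y ∈ Om) (hB : AnalyticAt ℂ Bf y)
    (hA : ∀ c, ¬ Tendsto Af (𝓝[≠] y) (𝓝 c)) : meromorphicOrderAt ff y < 0 := by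
  by_contra hh
  push Not at hh
  obtain ⟨c, hc⟩ := (tendsto_nhds_iff_meromorphicOrderAt_nonneg (ff_mero hy)).2 hh
  have t1 : Tendsto Bf (𝓝[≠] y) (𝓝 (Bf y)) := hB.continuousAt.tendsto.mono_left nhdsWithin_le_nhds
  have t2 : Tendsto tt (𝓝[≠] y) (𝓝 (tt y)) :=
    (tt_analytic hy).continuousAt.tendsto.mono_left nhdsWithin_le_nhds
  have t3 : Tendsto (fun z => 1 - Bf z - ff z * (1 - 4 * tt z)) (𝓝[≠] y)
      (𝓝 (1 - Bf y - c * (1 - 4 * tt y))) :=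
    (tendsto_const_nhds.sub t1).sub (hc.mul (tendsto_const_nhds.sub (tendsto_const_nhds.mul t2)))
  refine hA _ (t3.congr' ?_)
  refine Filter.Eventually.filter_mono nhdsWithin_le_nhds ?_
  filter_upwards [Om_open.mem_nhds hy] with z hz
  unfold ff
  rw [div_mul_cancel₀ _ (den_ne hz)]; ring

lemma Dop_order {y : ℂ} (hy : y ∈ Om) {k : ℤ} (hk : k < 0) (hf : meromorphicOrderAt ff y = k) (i : ℕ) :
    meromorphicOrderAt (Dop^[i] ff) y = ((k - i : ℤ) : WithTop ℤ) := by
  induction i with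
  | zero => simpa using hf
  | succ i ih =>
    rw [Function.iterate_succ_apply']
    unfold Dop
    rw [meromorphicOrderAt_mul_of_ne_zero (thi_analytic hy) (inv_ne_zero (th_ne hy))]
    have hne : ((k - i : ℤ) : ℂ) ≠ 0 := by
      rw [Int.cast_ne_zero]; omega
    have := meromorphicOrderAt_deriv_eq_sub_one hne ih
    unfold Dop at this
    rw [this]
    congr 1; push_cast; ring

lemma order_sum {y : ℂ} {m : ℤ} (s : Finset ℕ) (g : ℕ → ℂ → ℂ) (hg : ∀ i ∈ s, MeromorphicAt (g i) y)
    (h : ∀ i ∈ s, (m : WithTop ℤ) < meromorphicOrderAt (g i) y) :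
    (m : WithTop ℤ) < meromorphicOrderAt (∑ i ∈ s, g i) y := by
  classical
  induction s using Finset.induction_on with
  | empty =>
    have : meromorphicOrderAt (∑ i ∈ (∅ : Finset ℕ), g i) y = ⊤ := by
      rw [meromorphicOrderAt_eq_top_iff]; simp
    rw [this]; exact WithTop.coe_lt_top _
  | insert a s ha ih =>
    rw [sum_insert ha]
    refine lt_of_lt_of_le (lt_min (h a (mem_insert_self _ _))
      (ih (fun i hi => hg i (mem_insert_of_mem hi)) fun i hi => h i (mem_insert_of_mem hi)))
      (meromorphicOrderAt_add (hg a (mem_insert_self _ _))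
        (MeromorphicAt.sum fun i hi => hg i (mem_insert_of_mem hi)))

lemma good_eps {p : Polynomial ℚ} (hp : p ≠ 0) : ∃ ε₀ : ℝ, 0 < ε₀ ∧ ∀ ε, 0 < ε → ε < ε₀ →
    Polynomial.aeval (tt (yy ε)) p ≠ 0 := by
  set S : Set ℝ := {ε | 0 < ε ∧ Polynomial.aeval (tt (yy ε)) p = 0} with hS
  have hfin : S.Finite := by
    refine Set.Finite.of_finite_image (f := fun ε => tt (yy ε))
      ((Polynomial.rootSet_finite p ℂ).subset ?_) ?_
    · rintro _ ⟨ε, hε, rfl⟩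
      exact (Polynomial.mem_rootSet.2 ⟨hp, hε.2⟩)
    · intro a ha b hb hab
      have h1 : tu (yy a) = tu (yy b) := inv_injective hab
      rw [tu_yy ha.1, tu_yy hb.1] at h1
      have h3 := mul_left_cancel₀ (mul_ne_zero two_ne_zero Complex.I_ne_zero) h1
      exact Real.sinh_injective (by exact_mod_cast h3)
  have h0 : (0:ℝ) ∉ S := fun h => lt_irrefl _ h.1
  obtain ⟨δ, hδ, hb⟩ := Metric.mem_nhds_iff.1 (hfin.isClosed.isOpen_compl.mem_nhds h0)
  refine ⟨δ, hδ, fun ε h1 h2 h3 => ?_⟩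
  have : ε ∈ Metric.ball (0:ℝ) δ := by
    rw [mem_ball_zero_iff, Real.norm_eq_abs, abs_of_pos h1]; exact h2
  exact hb this ⟨h1, h3⟩

theorem main_aux (r : ℕ) (p : ℕ → Polynomial ℚ) (hp : ∃ i, i ≤ r ∧ p i ≠ 0)
    (h : ∑ i ∈ range (r + 1),
      (p i : PowerSeries ℚ) * (PowerSeries.derivativeFun^[i] (walkGF SE)) = 0) : False := by
  classical
  obtain ⟨i₀, hi₀, hpi₀⟩ := hp
  set s := (range (r+1)).filter fun i => p i ≠ 0 with hs
  have hne : s.Nonempty := ⟨i₀, by rw [hs, mem_filter, mem_range]; exact ⟨by omega, hpi₀⟩⟩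
  set j := s.max' hne with hj
  have hjs : j ∈ s := s.max'_mem hne
  have hjr : j ∈ range (r+1) := (mem_filter.1 hjs).1
  have hpj : p j ≠ 0 := (mem_filter.1 hjs).2
  obtain ⟨ε₀, hε₀, hgood⟩ := good_eps hpj
  obtain ⟨ε, h1, h2, hB, hA⟩ := poles hε₀
  have hy := yy_mem h1
  have hz := hgood ε h1 h2
  generalize yy ε = y at *
  have hneg := ff_order hy hB hA
  obtain ⟨k, hk⟩ := WithTop.ne_top_iff_exists.1 (ne_top_of_lt hneg)
  have hk0 : k < 0 := by rw [← hk] at hneg; exact_mod_cast hneg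
  have hord := Dop_order hy hk0 hk.symm
  have htop := phi_zero h hy
  rw [← add_sum_erase _ _ hjr] at htop
  have hmer : ∀ i, MeromorphicAt ((fun y => Polynomial.aeval (tt y) (p i)) * (Dop^[i] ff)) y :=
    fun i => (poly_analytic hy (p i)).meromorphicAt.mul (Dop_iter_mero hy i)
  have hlead : meromorphicOrderAt ((fun y => Polynomial.aeval (tt y) (p j)) * (Dop^[j] ff)) y
      = ((k - j : ℤ) : WithTop ℤ) := by
    rw [meromorphicOrderAt_mul_of_ne_zero (poly_analytic hy _) hz, hord]
  have hrest : ((k - j : ℤ) : WithTop ℤ) < meromorphicOrderAt (∑ i ∈ (range (r+1)).erase j,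
      (fun y => Polynomial.aeval (tt y) (p i)) * (Dop^[i] ff)) y := by
    refine order_sum _ _ (fun i _ => hmer i) fun i hi => ?_
    by_cases hpi : p i = 0
    · have : meromorphicOrderAt ((fun y => Polynomial.aeval (tt y) (p i)) * (Dop^[i] ff)) y = ⊤ := by
        rw [meromorphicOrderAt_eq_top_iff]
        exact Eventually.of_forall fun z => by simp [hpi]
      rw [this]; exact WithTop.coe_lt_top _
    · have hij : i < j := by
        refine lt_of_le_of_ne (s.le_max' i (mem_filter.2 ⟨mem_of_mem_erase hi, hpi⟩)) (ne_of_mem_erase hi)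
      rw [meromorphicOrderAt_mul (poly_analytic hy _).meromorphicAt (Dop_iter_mero hy i), hord]
      have h0 := (poly_analytic hy (p i)).meromorphicOrderAt_nonneg
      refine lt_of_lt_of_le ?_ (le_add_of_nonneg_left h0)
      exact_mod_cast (by omega : k - (j:ℤ) < k - (i:ℤ))
  rw [meromorphicOrderAt_add_eq_left_of_lt
    (MeromorphicAt.sum fun i _ => hmer i) (by rw [hlead]; exact hrest), hlead] at htop
  exact WithTop.coe_ne_top htop

end ModelE

theorem modelE_not_DFinite :
    ¬ ∃ (r : ℕ) (p : ℕ → Polynomial ℚ),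
      (∃ i, i ≤ r ∧ p i ≠ 0) ∧
      ∑ i ∈ Finset.range (r + 1),
        (p i : PowerSeries ℚ) *
          (PowerSeries.derivativeFun^[i] (walkGF ({(-1,1),(0,1),(1,1),(1,-1)} : Finset (ℤ × ℤ)))) = 0 := by
  rintro ⟨r, p, hp, h⟩
  exact ModelE.main_aux r p hp h
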